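/- Let p > 3 be a prime and let h_p denote the class number of the imaginary quadratic field ℚ(√−p). Then ∑_{1 ≤ a ≤ p−1, (a|p) = 1} (a/p) = (p − 1)/4 if p ≡ 1 (mod 4), and ∑_{1 ≤ a ≤ p−1, (a|p) = 1} (a/p) = (p − 1)/4 − h_p/2 if p ≡ 3 (mod 4), where the sum runs over the quadratic residues a modulo p in the range 1 ≤ a ≤ p − 1. -/

import Mathlib

section
open Filter Topology

lemma aux_bound {a s : ℝ} (ha0 : 0 < a) (ha1 : a < 1) (hs1 : 1 < s) (hs2 : s < 2) (n : ℕ) :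
    ‖((n + a : ℝ) ^ (-s) - (n + 1 - a : ℝ) ^ (-s)) / 2‖ ≤
      (min a (1 - a)) ^ (-3 : ℝ) * ((n + 1 : ℝ) ^ (-2 : ℝ)) := by
  set d := min a (1 - a) with hd
  have hd0 : 0 < d := lt_min ha0 (by linarith)
  have hda : d ≤ a := min_le_left _ _
  have hda' : d ≤ 1 - a := min_le_right _ _
  have hn : (0 : ℝ) ≤ n := Nat.cast_nonneg n
  have hdn : 0 < d * (n + 1) := by positivity
  have key : ‖((n + a : ℝ) ^ (-s) - (n + 1 - a : ℝ) ^ (-s))‖ ≤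
      (2 * (d ^ (-3 : ℝ) * ((n + 1 : ℝ) ^ (-2 : ℝ)))) * ‖(n + a : ℝ) - (n + 1 - a)‖ := by
    refine (convex_Ici (d * (n + 1 : ℝ))).norm_image_sub_le_of_norm_hasDerivWithin_le
      (f := fun x : ℝ => x ^ (-s)) (f' := fun x => (-s) * x ^ (-s - 1)) ?_ ?_ ?_ ?_
    · intro x hx
      have hx0 : 0 < x := lt_of_lt_of_le hdn hx
      exact (Real.hasDerivAt_rpow_const (Or.inl hx0.ne')).hasDerivWithinAt
    · intro x hx
      have hx0 : 0 < x := lt_of_lt_of_le hdn hx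
      rw [norm_mul, norm_neg, Real.norm_of_nonneg (by linarith : 0 ≤ s),
        Real.norm_of_nonneg (by positivity)]
      have h1 : x ^ (-s - 1) ≤ (d * (n + 1)) ^ (-s - 1) :=
        Real.rpow_le_rpow_of_nonpos hdn hx (by linarith)
      rw [Real.mul_rpow hd0.le (by positivity)] at h1
      have h2 : d ^ (-s - 1) ≤ d ^ (-3 : ℝ) :=
        Real.rpow_le_rpow_of_exponent_ge hd0 (by linarith) (by linarith)
      have h3 : (n + 1 : ℝ) ^ (-s - 1) ≤ (n + 1 : ℝ) ^ (-2 : ℝ) :=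
        Real.rpow_le_rpow_of_exponent_le (by linarith) (by linarith)
      have h4 : x ^ (-s - 1) ≤ d ^ (-3 : ℝ) * ((n + 1 : ℝ) ^ (-2 : ℝ)) :=
        h1.trans (mul_le_mul h2 h3 (by positivity) (by positivity))
      exact mul_le_mul hs2.le h4 (by positivity) (by positivity)
    · simp only [Set.mem_Ici]; nlinarith
    · simp only [Set.mem_Ici]; nlinarith
  have h5 : ‖(n + a : ℝ) - (n + 1 - a)‖ ≤ 1 := by
    rw [Real.norm_eq_abs, abs_le]; constructor <;> linarith
  rw [norm_div, Real.norm_two]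
  have : 0 ≤ (d ^ (-3 : ℝ) * ((n + 1 : ℝ) ^ (-2 : ℝ))) := by positivity
  nlinarith

lemma hurwitzZetaOdd_one {a : ℝ} (ha0 : 0 < a) (ha1 : a < 1) :
    HurwitzZeta.hurwitzZetaOdd a 1 = Real.pi / 2 * Complex.cot (Real.pi * a) := by
  -- limit from continuity
  have hcont : Tendsto (fun s : ℝ => HurwitzZeta.hurwitzZetaOdd a (s : ℂ)) (𝓝[>] 1)
      (𝓝 (HurwitzZeta.hurwitzZetaOdd a 1)) := by
    have h := (HurwitzZeta.differentiable_hurwitzZetaOdd (a : UnitAddCircle)).continuous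
    have h2 : Continuous (fun s : ℝ => HurwitzZeta.hurwitzZetaOdd a (s : ℂ)) :=
      h.comp Complex.continuous_ofReal
    have := h2.tendsto 1
    simp only [Complex.ofReal_one] at this
    exact this.mono_left nhdsWithin_le_nhds
  have hsum : Summable (fun n : ℕ => (min a (1 - a)) ^ (-3 : ℝ) * ((n + 1 : ℝ) ^ (-2 : ℝ))) := by
    apply Summable.mul_left
    have := (summable_nat_add_iff 1).mpr (Real.summable_nat_rpow.mpr (by norm_num : (-2:ℝ) < -1))
    exact_mod_cast this
  have hdct : Tendsto (fun s : ℝ => ∑' n : ℕ, ((n + a : ℝ) ^ (-s) - (n + 1 - a : ℝ) ^ (-s)) / 2)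
      (𝓝[>] 1) (𝓝 (∑' n : ℕ, ((n + a : ℝ) ^ (-1 : ℝ) - (n + 1 - a : ℝ) ^ (-1 : ℝ)) / 2)) := by
    refine tendsto_tsum_of_dominated_convergence hsum ?_ ?_
    · intro n
      have hn : (0 : ℝ) ≤ n := Nat.cast_nonneg n
      have : ContinuousAt (fun s : ℝ => ((n + a : ℝ) ^ (-s) - (n + 1 - a : ℝ) ^ (-s)) / 2) 1 := by
        have h1 : (n + a : ℝ) ≠ 0 := by positivity
        have h2 : (n + 1 - a : ℝ) ≠ 0 := by linarith
        have c1 : ContinuousAt (fun s : ℝ => (n + a : ℝ) ^ (-s)) 1 :=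
          ContinuousAt.rpow continuousAt_const continuousAt_neg (Or.inl h1)
        have c2 : ContinuousAt (fun s : ℝ => (n + 1 - a : ℝ) ^ (-s)) 1 :=
          ContinuousAt.rpow continuousAt_const continuousAt_neg (Or.inl h2)
        exact (c1.sub c2).div_const 2
      exact this.tendsto.mono_left nhdsWithin_le_nhds
    · filter_upwards [Ioo_mem_nhdsGT (by norm_num : (1:ℝ) < 2)] with s hs n
      exact aux_bound ha0 ha1 hs.1 hs.2 n
  have heq : ∀ᶠ s : ℝ in 𝓝[>] 1, HurwitzZeta.hurwitzZetaOdd a (s : ℂ) =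
      ((∑' n : ℕ, ((n + a : ℝ) ^ (-s) - (n + 1 - a : ℝ) ^ (-s)) / 2 : ℝ) : ℂ) := by
    filter_upwards [self_mem_nhdsWithin] with s hs
    have := HurwitzZeta.hasSum_nat_hurwitzZetaOdd_of_mem_Icc (a := a) ⟨ha0.le, ha1.le⟩
      (s := (s : ℂ)) (by simpa using hs)
    rw [← this.tsum_eq, Complex.ofReal_tsum]
    congr 1
    ext n
    have hn : (0 : ℝ) ≤ n := Nat.cast_nonneg n
    have h1 : (0:ℝ) ≤ (n + a : ℝ) := by positivity
    have h2 : (0:ℝ) ≤ (n + 1 - a : ℝ) := by linarith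
    rw [Real.rpow_neg h1, Real.rpow_neg h2]
    push_cast
    rw [Complex.ofReal_cpow h1, Complex.ofReal_cpow h2]
    push_cast
    simp only [one_div]
  have hlim : HurwitzZeta.hurwitzZetaOdd a 1 =
      ((∑' n : ℕ, ((n + a : ℝ) ^ (-1 : ℝ) - (n + 1 - a : ℝ) ^ (-1 : ℝ)) / 2 : ℝ) : ℂ) := by
    refine tendsto_nhds_unique hcont ?_
    refine Tendsto.congr' (heq.mono fun s h => h.symm) ?_
    exact (Complex.continuous_ofReal.tendsto _).comp hdct
  have hsum1 : Summable (fun n : ℕ => ((n + a : ℝ) ^ (-1 : ℝ) - (n + 1 - a : ℝ) ^ (-1 : ℝ)) / 2) := by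
    refine Summable.of_norm_bounded hsum ?_
    intro n
    have hn : (0 : ℝ) ≤ n := Nat.cast_nonneg n
    have h1 : (n + a : ℝ) ≠ 0 := by positivity
    have h2 : (n + 1 - a : ℝ) ≠ 0 := by linarith
    have c1 : ContinuousAt (fun s : ℝ => (n + a : ℝ) ^ (-s)) 1 :=
      ContinuousAt.rpow continuousAt_const continuousAt_neg (Or.inl h1)
    have c2 : ContinuousAt (fun s : ℝ => (n + 1 - a : ℝ) ^ (-s)) 1 :=
      ContinuousAt.rpow continuousAt_const continuousAt_neg (Or.inl h2)
    have := (((c1.sub c2).div_const 2).norm.tendsto.mono_left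
      (nhdsWithin_le_nhds : 𝓝[>] (1:ℝ) ≤ _))
    refine le_of_tendsto this ?_
    filter_upwards [Ioo_mem_nhdsGT (by norm_num : (1:ℝ) < 2)] with s hs
    exact aux_bound ha0 ha1 hs.1 hs.2 n
  rw [hlim]
  have hmem : (a : ℂ) ∈ Complex.integerComplement := by
    rw [Complex.mem_integerComplement_iff]
    rintro ⟨k, hk⟩
    have : (k : ℝ) = a := by exact_mod_cast hk
    have h1 : (0:ℝ) < k := by linarith
    have h2 : (k:ℝ) < 1 := by linarith
    have h1' : 0 < k := by exact_mod_cast h1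
    have h2' : k < 1 := by exact_mod_cast h2
    omega
  have hT : Tendsto (fun N : ℕ => ((∑ n ∈ Finset.range N,
      ((n + a : ℝ) ^ (-1 : ℝ) - (n + 1 - a : ℝ) ^ (-1 : ℝ)) / 2 : ℝ) : ℂ)) atTop _ :=
    (Complex.continuous_ofReal.tendsto _).comp hsum1.hasSum.tendsto_sum_nat
  refine tendsto_nhds_unique hT ?_
  have hpart : ∀ N : ℕ, ((∑ n ∈ Finset.range N,
      ((n + a : ℝ) ^ (-1 : ℝ) - (n + 1 - a : ℝ) ^ (-1 : ℝ)) / 2 : ℝ) : ℂ) =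
      (1 / a + ∑ j ∈ Finset.range N, cotTerm a j - (((a + N)⁻¹ : ℝ) : ℂ)) / 2 := by
    intro N
    induction N with
    | zero => simp
    | succ N ih =>
      rw [Finset.sum_range_succ, Complex.ofReal_add, ih, Finset.sum_range_succ]
      simp only [Real.rpow_neg_one, cotTerm]
      push_cast
      have e1 : (1 : ℂ) / (a - (N + 1)) = - (N + 1 - a : ℂ)⁻¹ := by
        rw [← neg_sub, one_div, inv_neg]
      rw [e1, add_comm (N : ℂ) a, ← add_assoc (a : ℂ) N 1]
      ring
  simp_rw [hpart]
  have h0 : Tendsto (fun N : ℕ => (((a + N)⁻¹ : ℝ) : ℂ)) atTop (𝓝 ((0 : ℝ) : ℂ)) := by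
    refine (Complex.continuous_ofReal.tendsto _).comp ?_
    exact tendsto_inv_atTop_zero.comp
      (tendsto_atTop_add_const_left _ _ tendsto_natCast_atTop_atTop)
  have := (((tendsto_logDeriv_euler_cot_sub hmem).const_add (1 / (a : ℂ))).sub h0).div_const 2
  convert this using 2
  push_cast
  ring
end

section
open Polynomial Finset

lemma theta_sum (p : ℕ) [Fact p.Prime] (i : ℕ) (hi : i ≤ p - 1) :
    ∃ u : (ZMod p)[X], ∑ j ∈ range p, C ((j : ZMod p) ^ i) * X ^ j = (X - 1) ^ (p - 1 - i) * u ∧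
      u.eval 1 = (-1) ^ i * (i.factorial : ZMod p) := by
  have hp : p.Prime := Fact.out
  induction i with
  | zero =>
    refine ⟨1, ?_, by simp⟩
    have h : (X - 1 : (ZMod p)[X]) ≠ 0 := by
      simpa using X_sub_C_ne_zero (1 : ZMod p)
    apply mul_left_cancel₀ h
    have h1 := mul_geom_sum (X : (ZMod p)[X]) p
    simp only [pow_zero, map_one, one_mul, mul_one, Nat.sub_zero]
    rw [h1, ← pow_succ', Nat.sub_add_cancel hp.one_le, sub_pow_char, one_pow]
  | succ i ih =>
    obtain ⟨u, hu, hu1⟩ := ih (by omega)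
    obtain ⟨r, hr⟩ : ∃ r, p - 1 - i = r + 1 := ⟨p - 1 - i - 1, by omega⟩
    refine ⟨((r + 1 : ℕ) : (ZMod p)[X]) * X * u + (X - 1) * X * derivative u, ?_, ?_⟩
    · have h := congrArg (fun g => X * derivative g) hu
      rw [hr] at h
      have e1 : p - 1 - (i + 1) = r := by omega
      rw [e1]
      have e2 : X * derivative (∑ j ∈ range p, C ((j : ZMod p) ^ i) * X ^ j) =
          ∑ j ∈ range p, C ((j : ZMod p) ^ (i + 1)) * X ^ j := by
        rw [derivative_sum, mul_sum]
        refine sum_congr rfl fun j _ => ?_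
        rw [derivative_C_mul_X_pow]
        rcases j with _ | j
        · simp
        · simp only [pow_succ, C_mul, Nat.add_sub_cancel]
          ring
      rw [← e2, h]
      simp only [derivative_mul, derivative_pow, derivative_sub, derivative_X, derivative_one]
      push_cast
      simp
      ring
    · simp only [eval_add, eval_mul, eval_sub, eval_X, eval_one, hu1, eval_natCast]
      have : ((r + 1 : ℕ) : ZMod p) = - ((i + 1 : ℕ) : ZMod p) := by
        have h : r + 1 + (i + 1) = p := by have := hp.one_le; omega
        have := congrArg (Nat.cast (R := ZMod p)) h
        rw [Nat.cast_add, ZMod.natCast_self] at this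
        exact eq_neg_of_add_eq_zero_left this
      rw [this, Nat.factorial_succ]
      push_cast
      ring

lemma prod_theta (p : ℕ) [Fact p.Prime] (m : ℕ) :
    ∃ v : (ZMod p)[X], ∏ k ∈ range m, (X ^ ((k + 1) * m) - X ^ ((k + 1) * (m + 1)))
       = (X - 1) ^ m * v ∧ v.eval 1 = (-1) ^ m * (m.factorial : ZMod p) := by
  refine ⟨∏ k ∈ range m, (- (X ^ ((k + 1) * m) * ∑ i ∈ range (k + 1), X ^ i)), ?_, ?_⟩
  · have : (X - 1 : (ZMod p)[X]) ^ m = ∏ k ∈ range m, (X - 1) := by simp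
    rw [this, ← prod_mul_distrib]
    refine prod_congr rfl fun k _ => ?_
    have h1 := mul_geom_sum (X : (ZMod p)[X]) (k + 1)
    have : (X - 1 : (ZMod p)[X]) * -(X ^ ((k + 1) * m) * ∑ i ∈ range (k + 1), X ^ i) =
      - X ^ ((k + 1) * m) * ((X - 1) * ∑ i ∈ range (k + 1), X ^ i) := by ring
    rw [this, h1]
    ring
  · rw [eval_prod]
    simp only [eval_neg, eval_mul, eval_pow, eval_X, one_pow, one_mul, eval_finsetSum, sum_const,
      card_range, nsmul_eq_mul, mul_one]
    rw [prod_neg, card_range, ← prod_range_add_one_eq_factorial]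
    push_cast
    rfl

lemma sign_poly (p : ℕ) [Fact p.Prime] (m : ℕ) (hpm : p = 2 * m + 1) (hm : 0 < m) (ζ : ℂ)
    (hζ : IsPrimitiveRoot ζ p) (ε : ℤ) (hε : ε = 1 ∨ ε = -1)
    (h : ∑ j ∈ range p, (quadraticChar (ZMod p) (j : ZMod p) : ℂ) * ζ ^ j =
      ε * ∏ k ∈ range m, (ζ ^ ((k + 1) * m) - ζ ^ ((k + 1) * (m + 1)))) : ε = 1 := by
  have hp : p.Prime := Fact.out
  set f : ℤ[X] := ∑ j ∈ range p, C (quadraticChar (ZMod p) (j : ZMod p)) * X ^ j -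
    C ε * ∏ k ∈ range m, (X ^ ((k + 1) * m) - X ^ ((k + 1) * (m + 1))) with hf
  have hf0 : aeval ζ f = 0 := by
    rw [hf]
    simp only [map_sub, map_mul, map_sum, map_prod, map_pow, aeval_X, aeval_C]
    simp only [eq_intCast]
    rw [sub_eq_zero]
    exact h
  have hdvd : cyclotomic p ℤ ∣ f := by
    rw [cyclotomic_eq_minpoly hζ hp.pos]
    exact minpoly.isIntegrallyClosed_dvd (hζ.isIntegral hp.pos) hf0
  have hdvd2 : cyclotomic p (ZMod p) ∣ f.map (Int.castRingHom (ZMod p)) := by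
    have := Polynomial.map_dvd (Int.castRingHom (ZMod p)) hdvd
    rwa [map_cyclotomic] at this
  have hX : (X - 1 : (ZMod p)[X]) ≠ 0 := by
      simpa using X_sub_C_ne_zero (1 : ZMod p)
  have hcyc : cyclotomic p (ZMod p) = (X - 1) ^ (p - 1) := by
    apply mul_right_cancel₀ hX
    rw [cyclotomic_prime_mul_X_sub_one, ← pow_succ, Nat.sub_add_cancel hp.one_le, sub_pow_char,
      one_pow]
  rw [hcyc] at hdvd2
  obtain ⟨u, hu, hu1⟩ := theta_sum p m (by omega)
  obtain ⟨v, hv, hv1⟩ := prod_theta p m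
  have hfm : f.map (Int.castRingHom (ZMod p)) = (X - 1) ^ m * (u - C (ε : ZMod p) * v) := by
    rw [hf]
    simp only [Polynomial.map_sub, Polynomial.map_mul, Polynomial.map_sum, Polynomial.map_prod,
      Polynomial.map_pow, map_X, map_C, Int.coe_castRingHom]
    rw [hv, mul_sub, show m = p - 1 - m by omega, ← show m = p - 1 - m by omega]
    have e : p - 1 - m = m := by omega
    rw [e] at hu
    rw [← hu, mul_left_comm]
    congr 1
    refine sum_congr rfl fun j _ => ?_
    congr 2
    rw [quadraticChar_eq_pow_of_char_ne_two']
    · rw [ZMod.card]; congr 1; omega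
    · rw [ZMod.ringChar_zmod_n]; omega
  rw [hfm, show p - 1 = m + m by omega, pow_add] at hdvd2
  have h3 : (X - 1 : (ZMod p)[X]) ^ m ∣ (u - C (ε : ZMod p) * v) :=
    (mul_dvd_mul_iff_left (pow_ne_zero m hX)).mp hdvd2
  have h4 : (u - C (ε : ZMod p) * v).eval 1 = 0 := by
    obtain ⟨w, hw⟩ := h3
    rw [hw]
    simp [hm.ne']
  simp only [eval_sub, eval_mul, eval_C, hu1, hv1] at h4
  have hfac : (m.factorial : ZMod p) ≠ 0 := by
    rw [Ne, ZMod.natCast_eq_zero_iff, hp.dvd_factorial]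
    omega
  rcases hε with rfl | rfl
  · rfl
  · exfalso
    push_cast at h4
    have h5 : (2 : ZMod p) * ((-1) ^ m * (m.factorial : ZMod p)) = 0 := by linear_combination h4
    have h2 : (2 : ZMod p) ≠ 0 := by
      have : ((2 : ℕ) : ZMod p) ≠ 0 := by
        rw [Ne, ZMod.natCast_eq_zero_iff]
        intro hd
        have := Nat.le_of_dvd (by norm_num) hd
        omega
      exact_mod_cast this
    have : (-1 : ZMod p) ^ m ≠ 0 := pow_ne_zero _ (by simp)
    exact (mul_ne_zero h2 (mul_ne_zero this hfac)) h5

lemma prod_I (q : ℕ) : ∏ k ∈ range (2 * q + 1), (Complex.I * (-1) ^ k) = Complex.I := by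
  induction q with
  | zero => simp
  | succ q ih =>
    rw [show 2 * (q + 1) + 1 = 2 * q + 1 + 1 + 1 by ring, prod_range_succ, prod_range_succ, ih]
    have h1 : (-1 : ℂ) ^ (2 * q + 1 + 1) = 1 := by
      rw [show 2 * q + 1 + 1 = 2 * (q + 1) by ring, pow_mul]; simp
    have h2 : (-1 : ℂ) ^ (2 * q + 1) = -1 := by rw [pow_succ, pow_mul]; simp
    rw [h1, h2]
    linear_combination (-Complex.I) * Complex.I_sq

lemma term_eq (p m k : ℕ) (hpm : p = 2 * m + 1) :
    Complex.exp (2 * Real.pi * Complex.I / p) ^ ((k + 1) * m) -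
      Complex.exp (2 * Real.pi * Complex.I / p) ^ ((k + 1) * (m + 1)) =
    Complex.I * (-1) ^ k * ((2 * Real.sin (Real.pi * (k + 1) / p) : ℝ) : ℂ) := by
  have hp : (p : ℂ) ≠ 0 := by
    exact_mod_cast (by omega : p ≠ 0)
  have hp2 : (p : ℂ) = 2 * m + 1 := by rw [hpm]; push_cast; ring
  rw [← Complex.exp_nat_mul, ← Complex.exp_nat_mul]
  have hk : (-1 : ℂ) ^ k = - Complex.exp ((k + 1 : ℕ) * (Real.pi * Complex.I)) := by
    rw [Complex.exp_nat_mul, Complex.exp_pi_mul_I]; ring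
  have e1 : (((k + 1) * m : ℕ) : ℂ) * (2 * Real.pi * Complex.I / p) =
      (k + 1 : ℕ) * (Real.pi * Complex.I) + -(Real.pi * (k + 1) / p) * Complex.I := by
    field_simp; push_cast; rw [hp2]; ring
  have e2 : (((k + 1) * (m + 1) : ℕ) : ℂ) * (2 * Real.pi * Complex.I / p) =
      (k + 1 : ℕ) * (Real.pi * Complex.I) + (Real.pi * (k + 1) / p) * Complex.I := by
    field_simp; push_cast; rw [hp2]; ring
  rw [e1, e2, Complex.exp_add, Complex.exp_add, hk]
  have hs : ((2 * Real.sin (Real.pi * (k + 1) / p) : ℝ) : ℂ) =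
      2 * Complex.sin (Real.pi * (k + 1) / p) := by push_cast; rfl
  rw [hs, Complex.two_sin]
  set A := Complex.exp ((k + 1 : ℕ) * (Real.pi * Complex.I))
  linear_combination (A * (Complex.exp (-(Real.pi * (k + 1) / p) * Complex.I) -
    Complex.exp ((Real.pi * (k + 1) / p) * Complex.I))) * Complex.I_sq

lemma prod_P (p m q : ℕ) (hpm : p = 2 * m + 1) (hmq : m = 2 * q + 1) :
    ∏ k ∈ range m, (Complex.exp (2 * Real.pi * Complex.I / p) ^ ((k + 1) * m) -
      Complex.exp (2 * Real.pi * Complex.I / p) ^ ((k + 1) * (m + 1))) =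
    Complex.I * (Real.sqrt p : ℂ) := by
  have hp0 : p ≠ 0 := by omega
  have hζ := Complex.isPrimitiveRoot_exp p hp0
  set ζ := Complex.exp (2 * Real.pi * Complex.I / p) with hζdef
  have h1 : ∏ k ∈ range m, (ζ ^ ((k + 1) * m) - ζ ^ ((k + 1) * (m + 1))) =
      Complex.I * ((∏ k ∈ range m, (2 * Real.sin (Real.pi * (k + 1) / p)) : ℝ) : ℂ) := by
    rw [prod_congr rfl fun k _ => term_eq p m k hpm, prod_mul_distrib]
    conv_lhs => rw [hmq, prod_I]
    rw [← hmq]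
    push_cast
    rfl
  have hpos : 0 < ∏ k ∈ range m, (2 * Real.sin (Real.pi * (k + 1) / p)) := by
    refine prod_pos fun k hk => ?_
    have hk' : k < m := mem_range.mp hk
    have hpp : (0 : ℝ) < p := by positivity
    have hlt : (k + 1 : ℝ) < p := by exact_mod_cast (by omega : k + 1 < p)
    refine mul_pos two_pos (Real.sin_pos_of_pos_of_lt_pi (by positivity) ?_)
    rw [div_lt_iff₀ hpp]
    exact mul_lt_mul_of_pos_left hlt Real.pi_pos
  have hnζ : ‖ζ‖ = 1 := hζ.norm'_eq_one hp0
  have hn1 : ∀ k, ‖ζ ^ ((k + 1) * m) - ζ ^ ((k + 1) * (m + 1))‖ = ‖1 - ζ ^ (k + 1)‖ := by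
    intro k
    have : ζ ^ ((k + 1) * m) - ζ ^ ((k + 1) * (m + 1)) = ζ ^ ((k + 1) * m) * (1 - ζ ^ (k + 1)) := by
      ring
    rw [this, norm_mul, norm_pow, hnζ, one_pow, one_mul]
  have hn2 : ‖∏ k ∈ range m, (ζ ^ ((k + 1) * m) - ζ ^ ((k + 1) * (m + 1)))‖ ^ 2 = p := by
    rw [norm_prod, prod_congr rfl fun k _ => hn1 k, sq]
    have h2 : ∏ k ∈ range m, ‖1 - ζ ^ (k + 1)‖ = ∏ k ∈ range m, ‖1 - ζ ^ (m + k + 1)‖ := by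
      rw [← prod_range_reflect]
      refine prod_congr rfl fun k hk => ?_
      have hk' : k < m := mem_range.mp hk
      have : ζ ^ (m - 1 - k + 1) * ζ ^ (m + k + 1) = 1 := by
        rw [← pow_add, show m - 1 - k + 1 + (m + k + 1) = p by omega, hζ.pow_eq_one]
      have e : 1 - ζ ^ (m - 1 - k + 1) = - ζ ^ (m - 1 - k + 1) * (1 - ζ ^ (m + k + 1)) := by
        linear_combination -this
      rw [e, norm_mul, norm_neg, norm_pow, hnζ, one_pow, one_mul]
    conv_lhs => rw [h2]
    nth_rewrite 1 [← h2]
    rw [← prod_range_add (fun k => ‖1 - ζ ^ (k + 1)‖), ← norm_prod]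
    have h3 : ∏ k ∈ range (m + m), (1 - ζ ^ (k + 1)) = ((m + m : ℕ) : ℂ) + 1 := by
      apply IsPrimitiveRoot.prod_one_sub_pow_eq_order
      rwa [show m + m + 1 = p by omega]
    rw [h3]
    have : ((m + m : ℕ) : ℂ) + 1 = ((p : ℕ) : ℂ) := by rw [hpm]; push_cast; ring
    rw [this, Complex.norm_natCast]
  rw [h1] at hn2 ⊢
  rw [norm_mul, Complex.norm_I, one_mul, Complex.norm_of_nonneg hpos.le] at hn2
  rw [show Real.sqrt p = _ from by rw [← hn2, Real.sqrt_sq hpos.le]]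

/-- the quadratic Dirichlet character -/
noncomputable def qchi (p : ℕ) [Fact p.Prime] : DirichletCharacter ℂ p :=
  (quadraticChar (ZMod p)).ringHomComp (Int.castRingHom ℂ)

lemma qchi_apply (p : ℕ) [Fact p.Prime] (a : ZMod p) :
    qchi p a = (quadraticChar (ZMod p) a : ℂ) := by
  simp [qchi, MulChar.ringHomComp_apply]

lemma stdAddChar_pow (p : ℕ) [NeZero p] (j : ℕ) :
    ZMod.stdAddChar (j : ZMod p) = Complex.exp (2 * Real.pi * Complex.I / p) ^ j := by
  have := ZMod.stdAddChar_coe (N := p) (j : ℤ)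
  rw [← Complex.exp_nat_mul]
  push_cast at this
  rw [this]
  congr 1
  ring

lemma sum_zmod (p : ℕ) [NeZero p] {M : Type*} [AddCommMonoid M] (f : ZMod p → M) :
    ∑ a : ZMod p, f a = ∑ j ∈ range p, f (j : ZMod p) := by
  symm
  refine sum_nbij' (fun j : ℕ => (j : ZMod p)) (fun a : ZMod p => a.val) ?_ ?_ ?_ ?_ ?_
  · simp
  · intro a _; exact mem_range.mpr (ZMod.val_lt a)
  · intro j hj; exact ZMod.val_cast_of_lt (mem_range.mp hj)
  · intro a _; simp
  · intros; rfl

lemma qchi_neg_one (p : ℕ) [Fact p.Prime] (hp3 : p % 4 = 3) : qchi p (-1) = -1 := by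
  rw [qchi_apply, quadraticChar_neg_one (by rw [ZMod.ringChar_zmod_n]; omega), ZMod.card,
    ZMod.χ₄_nat_three_mod_four hp3]
  simp

lemma qchi_ne_one (p : ℕ) [Fact p.Prime] (hp3 : p % 4 = 3) : qchi p ≠ 1 := by
  intro h
  have h1 := qchi_neg_one p hp3
  rw [h] at h1
  have : (1 : DirichletCharacter ℂ p) (-1) = 1 := MulChar.one_apply isUnit_one.neg
  rw [this] at h1
  norm_num at h1

lemma gauss_sign (p : ℕ) [Fact p.Prime] (hp3 : p % 4 = 3) :
    gaussSum (qchi p) ZMod.stdAddChar = Complex.I * (Real.sqrt p : ℂ) := by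
  have hp : p.Prime := Fact.out
  obtain ⟨q, hq⟩ : ∃ q, p = 4 * q + 3 := ⟨p / 4, by omega⟩
  set m := 2 * q + 1 with hm
  have hpm : p = 2 * m + 1 := by omega
  have hP := prod_P p m q hpm hm
  have hquad : (qchi p).IsQuadratic := (quadraticChar_isQuadratic (ZMod p)).comp _
  have hsq := gaussSum_sq (qchi_ne_one p hp3) hquad (ZMod.isPrimitive_stdAddChar p)
  rw [qchi_neg_one p hp3, ZMod.card] at hsq
  have hG : gaussSum (qchi p) ZMod.stdAddChar = ∑ j ∈ range p,
      (quadraticChar (ZMod p) (j : ZMod p) : ℂ) * Complex.exp (2 * Real.pi * Complex.I / p) ^ j := by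
    unfold gaussSum
    rw [sum_zmod p (fun a => qchi p a * ZMod.stdAddChar a)]
    refine sum_congr rfl fun j _ => ?_
    rw [qchi_apply, stdAddChar_pow]
  have hsqrt : (Real.sqrt p : ℂ) ^ 2 = p := by
    have := Real.sq_sqrt (Nat.cast_nonneg (α := ℝ) p)
    exact_mod_cast this
  have hor : gaussSum (qchi p) ZMod.stdAddChar = Complex.I * (Real.sqrt p : ℂ) ∨
      gaussSum (qchi p) ZMod.stdAddChar = -(Complex.I * (Real.sqrt p : ℂ)) := by
    apply sq_eq_sq_iff_eq_or_eq_neg.mp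
    rw [hsq, mul_pow, hsqrt, Complex.I_sq]
  rcases hor with h | h
  · exact h
  · exfalso
    have := sign_poly p m hpm (by omega) _ (Complex.isPrimitiveRoot_exp p hp.ne_zero) (-1)
      (Or.inr rfl) (by rw [← hG, hP, h]; push_cast; ring)
    norm_num at this
end

section
open Finset

lemma sum_j_pow (p : ℕ) (hp : p ≠ 0) (w : ℂ) (hw : w ^ p = 1) (hw1 : w ≠ 1) :
    ∑ k ∈ range p, (k : ℂ) * w ^ k = p / (w - 1) := by
  have h : ∀ n : ℕ, (w - 1) * ∑ k ∈ range n, (k : ℂ) * w ^ k =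
      n * w ^ n - w * ∑ k ∈ range n, w ^ k := by
    intro n
    induction n with
    | zero => simp
    | succ n ih => rw [sum_range_succ, sum_range_succ, mul_add, ih]; push_cast; ring
  have h0 : ∑ k ∈ range p, w ^ k = 0 := by
    have := mul_geom_sum w p
    rw [hw, sub_self] at this
    exact (mul_eq_zero.mp this).resolve_left (sub_ne_zero.mpr hw1)
  rw [eq_div_iff (sub_ne_zero.mpr hw1), mul_comm, h, h0, hw]
  ring

lemma cot_eq (p j : ℕ) (hj0 : 0 < j) (hjp : j < p) :
    Complex.cot (Real.pi * ((j / p : ℝ) : ℂ)) = Complex.I + 2 * Complex.I / p *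
      ∑ k ∈ range p, (k : ℂ) * (Complex.exp (2 * Real.pi * Complex.I / p) ^ j) ^ k := by
  have hp0 : p ≠ 0 := by omega
  have hpc : (p : ℂ) ≠ 0 := by exact_mod_cast hp0
  have hζ := Complex.isPrimitiveRoot_exp p hp0
  have hw : Complex.exp (2 * Complex.I * (Real.pi * ((j / p : ℝ) : ℂ))) =
     Complex.exp (2 * Real.pi * Complex.I / p) ^ j := by
    rw [← Complex.exp_nat_mul]
    congr 1
    push_cast
    ring
  rw [Complex.cot_eq_exp_ratio, hw]
  set w := Complex.exp (2 * Real.pi * Complex.I / p) ^ j with hwd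
  have hw1 : w ≠ 1 := hζ.pow_ne_one_of_pos_of_lt hj0.ne' hjp
  have hwp : w ^ p = 1 := by rw [hwd, ← pow_mul, mul_comm j p, pow_mul, hζ.pow_eq_one, one_pow]
  rw [sum_j_pow p hp0 w hwp hw1]
  have h1 : w - 1 ≠ 0 := sub_ne_zero.mpr hw1
  have h2 : 1 - w ≠ 0 := sub_ne_zero.mpr hw1.symm
  have hI := Complex.I_ne_zero
  have h3 : (1 - w)⁻¹ = - (w - 1)⁻¹ := by rw [← neg_sub, inv_neg]
  rw [div_eq_mul_inv, mul_inv, h3, Complex.inv_I]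
  field_simp
  ring

lemma L_one (p : ℕ) [Fact p.Prime] (hp3 : p % 4 = 3) :
    DirichletCharacter.LFunction (qchi p) 1 = -(Real.pi / (p * Real.sqrt p)) *
      ∑ j ∈ range p, (j : ℂ) * (quadraticChar (ZMod p) (j : ZMod p) : ℂ) := by
  have hp : p.Prime := Fact.out
  have hp0 : p ≠ 0 := hp.ne_zero
  have hpc : (p : ℂ) ≠ 0 := by exact_mod_cast hp0
  set ζ := Complex.exp (2 * Real.pi * Complex.I / p) with hζ
  have hodd : (qchi p : ZMod p → ℂ).Odd := by
    intro a
    have : -a = -1 * a := by ring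
    rw [this, map_mul, qchi_neg_one p hp3]; ring
  have hq0 : qchi p (0 : ZMod p) = 0 := by rw [qchi_apply]; simp
  have hterm : ∀ j ∈ range p, qchi p (j : ZMod p) *
      HurwitzZeta.hurwitzZetaOdd (ZMod.toAddCircle (j : ZMod p)) 1 =
      qchi p (j : ZMod p) * (Real.pi / 2 * (Complex.I + 2 * Complex.I / p *
        ∑ k ∈ range p, (k : ℂ) * (ζ ^ j) ^ k)) := by
    intro j hj
    rcases Nat.eq_zero_or_pos j with rfl | hj0
    · simp [hq0]
    · congr 1
      have hjp := mem_range.mp hj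
      have hpr : (0 : ℝ) < p := by exact_mod_cast hp.pos
      have := ZMod.toAddCircle_intCast (N := p) (j : ℤ)
      push_cast at this
      rw [this]
      have h1 := hurwitzZetaOdd_one (a := (j : ℝ) / p) (by positivity)
        (by rw [div_lt_one hpr]; exact_mod_cast hjp)
      rw [cot_eq p j hj0 hjp] at h1
      exact h1
  have hsum0 : ∑ j ∈ range p, qchi p (j : ZMod p) = 0 := by
    rw [← sum_zmod p (fun a => qchi p a)]
    exact MulChar.sum_eq_zero_of_ne_one (qchi_ne_one p hp3)
  have hgauss : ∀ k ∈ range p, ∑ j ∈ range p, qchi p (j : ZMod p) * (ζ ^ j) ^ k =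
      qchi p (k : ZMod p) * (Complex.I * Real.sqrt p) := by
    intro k hk
    rcases Nat.eq_zero_or_pos k with rfl | hk0
    · simp [hsum0, hq0]
    · have hu : IsUnit (k : ZMod p) := by
        rw [isUnit_iff_ne_zero, Ne, ZMod.natCast_eq_zero_iff]
        intro hd
        have := Nat.le_of_dvd hk0 hd
        have := mem_range.mp hk
        omega
      obtain ⟨u, hu⟩ := hu
      have hm := gaussSum_mulShift (qchi p) (ZMod.stdAddChar (N := p)) u
      rw [gauss_sign p hp3, hu] at hm
      rw [← hm, ← mul_assoc]
      have hsq : qchi p (k : ZMod p) * qchi p (k : ZMod p) = 1 := by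
        rw [qchi_apply]
        have := quadraticChar_sq_one (F := ZMod p) (a := (k : ZMod p)) (by rw [← hu]; exact u.ne_zero)
        rw [← sq]
        exact_mod_cast this
      rw [hsq, one_mul]
      unfold gaussSum
      rw [sum_zmod p (fun a => qchi p a * (ZMod.stdAddChar.mulShift (k : ZMod p)) a)]
      refine sum_congr rfl fun j _ => ?_
      rw [AddChar.mulShift_apply, ← Nat.cast_mul, stdAddChar_pow, ← pow_mul, mul_comm k j]
  have hdef := ZMod.LFunction_def_odd hodd 1
  have hsqrt : (Real.sqrt p : ℂ) ^ 2 = p := by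
    have := Real.sq_sqrt (Nat.cast_nonneg (α := ℝ) p)
    exact_mod_cast this
  have hs0 : (Real.sqrt p : ℂ) ≠ 0 := by
    intro h; rw [h] at hsqrt; apply hpc; rw [← hsqrt]; simp
  rw [DirichletCharacter.LFunction, hdef,
    sum_zmod p (fun j => qchi p j * HurwitzZeta.hurwitzZetaOdd (ZMod.toAddCircle j) 1),
    sum_congr rfl hterm, Complex.cpow_neg_one]
  have e1 : ∑ j ∈ range p, qchi p (j : ZMod p) * (Real.pi / 2 * (Complex.I + 2 * Complex.I / p *
        ∑ k ∈ range p, (k : ℂ) * (ζ ^ j) ^ k)) =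
      Real.pi / 2 * Complex.I * ∑ j ∈ range p, qchi p (j : ZMod p) + Real.pi * Complex.I / p *
        ∑ k ∈ range p, (k : ℂ) * ∑ j ∈ range p, qchi p (j : ZMod p) * (ζ ^ j) ^ k := by
    simp only [mul_sum]
    rw [sum_comm, ← sum_add_distrib]
    refine sum_congr rfl fun j _ => ?_
    rw [mul_add, mul_add, mul_sum, mul_sum]
    congr 1
    · ring
    · refine sum_congr rfl fun k _ => ?_
      ring
  rw [e1, hsum0, sum_congr rfl fun k hk => by rw [hgauss k hk]]
  simp only [qchi_apply, mul_sum, mul_zero, zero_add]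
  refine sum_congr rfl fun k _ => ?_
  have hi := Complex.I_sq
  generalize (Real.sqrt p : ℂ) = r at *
  rw [← hsqrt]
  field_simp
  linear_combination (k * (quadraticChar (ZMod p) (k : ZMod p) : ℂ)) * hi
end

section
open NumberField

lemma K_rep {p : ℕ} {K : Type} [Field K] [NumberField K] {α : K} (hα : α ^ 2 = -(p : K))
    (hgen : IntermediateField.adjoin ℚ {α} = ⊤) (z : K) : ∃ a b : ℚ, z = a + b * α := by
  have hint : IsIntegral ℚ α := Algebra.IsIntegral.isIntegral α
  have h1 : z ∈ (IntermediateField.adjoin ℚ {α}).toSubalgebra := by rw [hgen]; trivial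
  rw [IntermediateField.adjoin_simple_toSubalgebra_of_isAlgebraic hint.isAlgebraic] at h1
  induction h1 using Algebra.adjoin_induction with
  | mem x hx => rw [Set.mem_singleton_iff] at hx; exact ⟨0, 1, by simp [hx]⟩
  | algebraMap r => exact ⟨r, 0, by simp⟩
  | add x y _ _ hx hy =>
    obtain ⟨a, b, rfl⟩ := hx; obtain ⟨c, d, rfl⟩ := hy
    exact ⟨a + c, b + d, by push_cast; ring⟩
  | mul x y _ _ hx hy =>
    obtain ⟨a, b, rfl⟩ := hx; obtain ⟨c, d, rfl⟩ := hy
    exact ⟨a * c - b * d * p, a * d + b * c, by push_cast; linear_combination (b * d : K) * hα⟩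

lemma K_indep {p : ℕ} (hp : 0 < p) {K : Type} [Field K] [NumberField K] {α : K} (hα : α ^ 2 = -(p : K))
    (a b : ℚ) (h : (a : K) + b * α = 0) : a = 0 ∧ b = 0 := by
  have h1 : ((a ^ 2 + p * b ^ 2 : ℚ) : K) = 0 := by
    push_cast
    linear_combination (a - b * α : K) * h + (b : K) ^ 2 * hα
  have h2 : a ^ 2 + p * b ^ 2 = 0 := by exact_mod_cast h1
  have hp' : (0 : ℚ) < p := by exact_mod_cast hp
  have ha : 0 ≤ a ^ 2 := sq_nonneg a
  have hb : 0 ≤ b ^ 2 := sq_nonneg b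
  have : a ^ 2 = 0 := by nlinarith
  have hb2 : b ^ 2 = 0 := by nlinarith
  exact ⟨by simpa using this, by simpa using hb2⟩

noncomputable def Kbasis {p : ℕ} (hp : 0 < p) {K : Type} [Field K] [NumberField K] {α : K}
    (hα : α ^ 2 = -(p : K))
    (hgen : IntermediateField.adjoin ℚ {α} = ⊤) : Module.Basis (Fin 2) ℚ K :=
  Module.Basis.mk (v := ![1, α])
    (by
      rw [LinearIndependent.pair_iff]
      intro s t h
      apply K_indep hp hα s t
      rw [Rat.smul_def, Rat.smul_def] at h
      simpa using h)
    (by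
      intro z _
      obtain ⟨a, b, rfl⟩ := K_rep hα hgen z
      simp only [Matrix.range_cons, Matrix.range_empty, Set.union_empty, Set.singleton_union]
      rw [Submodule.mem_span_pair]
      exact ⟨a, b, by rw [Rat.smul_def, Rat.smul_def]; simp⟩)

section
variable {p : ℕ} (hp : 0 < p) {K : Type} [Field K] [NumberField K] {α : K}
    (hα : α ^ 2 = -(p : K)) (hgen : IntermediateField.adjoin ℚ {α} = ⊤)

lemma Kbasis_zero : Kbasis hp hα hgen 0 = 1 := by simp [Kbasis]
lemma Kbasis_one : Kbasis hp hα hgen 1 = α := by simp [Kbasis]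

lemma Kbasis_repr (a b : ℚ) : ⇑((Kbasis hp hα hgen).repr (a + b * α)) = ![a, b] := by
  have : (a : K) + b * α = a • Kbasis hp hα hgen 0 + b • Kbasis hp hα hgen 1 := by
    rw [Kbasis_zero, Kbasis_one, Rat.smul_def, Rat.smul_def]; simp
  rw [this, map_add, map_smul, map_smul, Module.Basis.repr_self, Module.Basis.repr_self]
  ext i
  fin_cases i <;> simp

include hp hα hgen in
lemma K_finrank : Module.finrank ℚ K = 2 := by
  rw [Module.finrank_eq_card_basis (Kbasis hp hα hgen)]; simp

lemma K_mat (a b : ℚ) : Algebra.leftMulMatrix (Kbasis hp hα hgen) (a + b * α) =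
    !![a, -(p * b); b, a] := by
  ext i j
  rw [Algebra.leftMulMatrix_eq_repr_mul]
  fin_cases j
  · have h := Kbasis_repr hp hα hgen a b
    simp only [Fin.zero_eta, Kbasis_zero, mul_one, h]
    fin_cases i <;> simp
  · have h := Kbasis_repr hp hα hgen (-(p * b)) a
    have e : ((a : K) + b * α) * α = ((-(p * b) : ℚ) : K) + a * α := by
      push_cast; linear_combination (b : K) * hα
    simp only [Fin.mk_one, Kbasis_one, e, h]
    fin_cases i <;> simp

include hp hα hgen in
lemma K_trace (a b : ℚ) : Algebra.trace ℚ K (a + b * α) = 2 * a := by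
  rw [Algebra.trace_eq_matrix_trace (Kbasis hp hα hgen), K_mat]
  simp [Matrix.trace_fin_two]; ring

include hp hα hgen in
lemma K_norm (a b : ℚ) : Algebra.norm ℚ (a + b * α : K) = a ^ 2 + p * b ^ 2 := by
  rw [Algebra.norm_eq_matrix_det (Kbasis hp hα hgen), K_mat]
  simp [Matrix.det_fin_two]; ring

end

lemma int_of_sq_mul {p : ℕ} (hp : p.Prime) (x : ℚ) (N : ℤ) (h : (p : ℚ) * x ^ 2 = N) :
    ∃ v : ℤ, x = v := by
  have hpz : Prime (p : ℤ) := Nat.prime_iff_prime_int.mp hp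
  have hint : IsIntegral ℤ ((p : ℚ) * x) := by
    refine IsIntegral.of_pow (n := 2) (by norm_num) ?_
    have : ((p : ℚ) * x) ^ 2 = algebraMap ℤ ℚ (p * N) := by
      simp; linear_combination (p : ℚ) * h
    rw [this]; exact isIntegral_algebraMap
  obtain ⟨w, hw⟩ := IsIntegrallyClosed.isIntegral_iff.mp hint
  have hw' : (w : ℚ) = p * x := by simpa using hw
  have h2 : w ^ 2 = p * N := by
    have : ((w ^ 2 : ℤ) : ℚ) = ((p * N : ℤ) : ℚ) := by
      push_cast; rw [hw']; linear_combination (p : ℚ) * h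
    exact_mod_cast this
  have : (p : ℤ) ∣ w := hpz.dvd_of_dvd_pow (n := 2) ⟨N, h2⟩
  obtain ⟨v, rfl⟩ := this
  refine ⟨v, ?_⟩
  have : (p : ℚ) ≠ 0 := by exact_mod_cast hp.ne_zero
  push_cast at hw'
  exact (mul_left_cancel₀ this hw').symm

/-- every integer is u + v * (1+α)/2 -/
lemma int_rep {p : ℕ} (hp : p.Prime) (hp4 : p % 4 = 3) {K : Type} [Field K] [NumberField K] {α : K}
    (hα : α ^ 2 = -(p : K)) (hgen : IntermediateField.adjoin ℚ {α} = ⊤) (z : 𝓞 K) :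
    ∃ u v : ℤ, (z : K) = u + v * ((1 + α) / 2) := by
  obtain ⟨a, b, hz⟩ := K_rep hα hgen (z : K)
  have hzi : IsIntegral ℤ (z : K) := z.isIntegral_coe
  have ht := Algebra.isIntegral_trace (L := ℚ) hzi
  have hn := Algebra.isIntegral_norm ℚ hzi
  rw [hz, K_trace hp.pos hα hgen] at ht
  rw [hz, K_norm hp.pos hα hgen] at hn
  obtain ⟨t, ht⟩ := IsIntegrallyClosed.isIntegral_iff.mp ht
  obtain ⟨n, hn⟩ := IsIntegrallyClosed.isIntegral_iff.mp hn
  have ht' : (t : ℚ) = 2 * a := by simpa using ht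
  have hn' : (n : ℚ) = a ^ 2 + p * b ^ 2 := by simpa using hn
  obtain ⟨v, hv⟩ := int_of_sq_mul hp (2 * b) (4 * n - t ^ 2) (by push_cast; rw [ht', hn']; ring)
  have key : t ^ 2 + p * v ^ 2 = 4 * n := by
    have : ((t ^ 2 + p * v ^ 2 : ℤ) : ℚ) = ((4 * n : ℤ) : ℚ) := by
      push_cast; rw [ht', hn', ← hv]; ring
    exact_mod_cast this
  have hpar : ∃ u, t - v = 2 * u := by
    obtain ⟨m, hm⟩ : ∃ m : ℤ, (p : ℤ) = 4 * m + 3 := ⟨p / 4, by omega⟩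
    rw [hm] at key
    have h4 : (t - v) * (t + v) = 4 * (n - (m + 1) * v ^ 2) := by linear_combination key
    have : (2 : ℤ) ∣ (t - v) * (t + v) := ⟨2 * (n - (m + 1) * v ^ 2), by rw [h4]; ring⟩
    rcases Int.prime_two.dvd_or_dvd this with h | h
    · exact h
    · obtain ⟨k, hk⟩ := h; exact ⟨k - v, by linear_combination hk⟩
  obtain ⟨u, hu⟩ := hpar
  refine ⟨u, v, ?_⟩
  have ha : a = u + v / 2 := by
    have : (t : ℚ) - v = 2 * u := by exact_mod_cast hu
    linarith
  have hb : b = v / 2 := by linarith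
  rw [hz, ha, hb]; push_cast; ring
end

section
open NumberField

section
variable {p : ℕ} (hp : p.Prime) (hp4 : p % 4 = 3) {K : Type} [Field K] [NumberField K] {α : K}
    (hα : α ^ 2 = -(p : K)) (hgen : IntermediateField.adjoin ℚ {α} = ⊤)

variable {c : ℕ} (hc : p + 1 = 4 * c)

include hc hα in
lemma exists_theta : ∃ θ : 𝓞 K, (θ : K) = (1 + α) / 2 ∧ θ * θ = θ - (c : 𝓞 K) := by
  have hc : (4 : K) * (c : K) = p + 1 := by
    exact_mod_cast hc.symm
  have hsq : ((1 + α) / 2) * ((1 + α) / 2) = (1 + α) / 2 - (c : K) := by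
    linear_combination hα / 4 + hc / 4
  have hint : IsIntegral ℤ ((1 + α) / 2) := by
    refine ⟨Polynomial.X ^ 2 - Polynomial.X + Polynomial.C (c : ℤ), ?_, ?_⟩
    · monicity!
    · simp [Polynomial.eval₂_add, Polynomial.eval₂_sub]
      linear_combination hsq
  obtain ⟨θ, hθ⟩ : ∃ θ : 𝓞 K, (θ : K) = (1 + α) / 2 :=
    ⟨⟨(1 + α) / 2, (mem_integralClosure_iff _ _).mpr hint⟩, rfl⟩
  refine ⟨θ, hθ, ?_⟩
  apply RingOfIntegers.ext
  simp [hθ, hsq]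

variable {θ : 𝓞 K} (hθ : (θ : K) = (1 + α) / 2)

include hp hp4 hα hgen hθ in
lemma int_rep' (z : 𝓞 K) : ∃ u v : ℤ, z = u + v * θ := by
  obtain ⟨u, v, h⟩ := int_rep hp hp4 hα hgen z
  refine ⟨u, v, RingOfIntegers.ext ?_⟩
  rw [h]; simp [hθ]

include hp hα hθ in
lemma int_indep (u v : ℤ) (h : (u : 𝓞 K) + v * θ = 0) : u = 0 ∧ v = 0 := by
  have h1 : ((u + v / 2 : ℚ) : K) + ((v / 2 : ℚ) : K) * α = 0 := by
    have : ((u + v * θ : 𝓞 K) : K) = 0 := by rw [h]; rfl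
    simp [hθ] at this
    push_cast
    linear_combination this
  obtain ⟨h2, h3⟩ := K_indep hp.pos hα _ _ h1
  have hv : (v : ℚ) = 0 := by linarith
  have hu : (u : ℚ) = 0 := by linarith
  exact ⟨by exact_mod_cast hu, by exact_mod_cast hv⟩

include hp hα hgen hθ in
lemma int_trace (u v : ℤ) : Algebra.trace ℤ (𝓞 K) (u + v * θ) = 2 * u + v := by
  have h := Algebra.coe_trace_int (K := K) (u + v * θ)
  have e : ((u + v * θ : 𝓞 K) : K) = ((u + v / 2 : ℚ) : K) + ((v / 2 : ℚ) : K) * α := by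
    simp [hθ]; ring
  rw [e, K_trace hp.pos hα hgen] at h
  have : ((Algebra.trace ℤ (𝓞 K) (u + v * θ) : ℤ) : ℚ) = ((2 * u + v : ℤ) : ℚ) := by
    rw [h]; push_cast; ring
  exact_mod_cast this

include hc hp hα hgen hθ in
lemma int_norm (u v : ℤ) : Algebra.norm ℤ (u + v * θ) = u ^ 2 + u * v + c * v ^ 2 := by
  have h := Algebra.coe_norm_int (K := K) (u + v * θ)
  have e : ((u + v * θ : 𝓞 K) : K) = ((u + v / 2 : ℚ) : K) + ((v / 2 : ℚ) : K) * α := by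
    simp [hθ]; ring
  rw [e, K_norm hp.pos hα hgen] at h
  have hc : (4 : ℚ) * (c : ℚ) = p + 1 := by
    exact_mod_cast hc.symm
  have : ((Algebra.norm ℤ (u + v * θ) : ℤ) : ℚ) =
      ((u ^ 2 + u * v + c * v ^ 2 : ℤ) : ℚ) := by
    rw [h]; push_cast at hc ⊢; linear_combination (-(v : ℚ) ^ 2 / 4) * hc
  exact_mod_cast this

include hp hp4 hα hgen in
lemma K_discr : NumberField.discr K = -p := by
  obtain ⟨c, hc⟩ : ∃ c, p + 1 = 4 * c := ⟨(p + 1) / 4, by omega⟩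
  obtain ⟨θ, hθ, hθ2⟩ := exists_theta hα hc
  let b : Module.Basis (Fin 2) ℤ (𝓞 K) := Module.Basis.mk (v := ![1, θ])
    (by
      rw [LinearIndependent.pair_iff]
      intro s t h
      apply int_indep hp hα hθ s t
      simpa using h)
    (by
      intro z _
      obtain ⟨u, v, rfl⟩ := int_rep' hp hp4 hα hgen hθ z
      simp only [Matrix.range_cons, Matrix.range_empty, Set.union_empty, Set.singleton_union]
      rw [Submodule.mem_span_pair]
      exact ⟨u, v, by simp⟩)
  have b0 : b 0 = 1 := by simp [b]
  have b1 : b 1 = θ := by simp [b]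
  rw [← NumberField.discr_eq_discr K b, Algebra.discr_def, Matrix.det_fin_two]
  simp only [Algebra.traceMatrix_apply, Algebra.traceForm_apply, b0, b1, one_mul, mul_one, hθ2]
  have t1 := int_trace hp hα hgen hθ 1 0
  have t2 := int_trace hp hα hgen hθ 0 1
  have t3 := int_trace hp hα hgen hθ (-(c : ℤ)) 1
  have e3 : (((-(c : ℤ) : ℤ)) : 𝓞 K) + ((1 : ℤ) : 𝓞 K) * θ =
    θ - (c : 𝓞 K) := by push_cast; ring
  rw [e3] at t3
  have e1 : ((1 : ℤ) : 𝓞 K) + ((0 : ℤ) : 𝓞 K) * θ = 1 := by simp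
  have e2 : ((0 : ℤ) : 𝓞 K) + ((1 : ℤ) : 𝓞 K) * θ = θ := by simp
  rw [e1] at t1
  rw [e2] at t2
  rw [t1, t2, t3]
  omega

include hp hα in
lemma K_complex : NumberField.IsTotallyComplex K := by
  constructor
  intro w
  rw [← InfinitePlace.not_isReal_iff_isComplex]
  intro hr
  obtain ⟨φ, hφ, rfl⟩ := hr
  have h1 : (φ α) ^ 2 = -p := by rw [← map_pow, hα]; simp
  have h2 : (starRingEnd ℂ) (φ α) = φ α := by
    exact RingHom.congr_fun (ComplexEmbedding.isReal_iff.mp hφ) α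
  obtain ⟨r, hr⟩ := Complex.conj_eq_iff_real.mp h2
  rw [hr] at h1
  have h3 : r ^ 2 = -p := by exact_mod_cast h1
  have : (0 : ℝ) < p := by exact_mod_cast hp.pos
  nlinarith [sq_nonneg r]

include hp hp4 hα hgen in
lemma K_units (h3 : 3 < p) (x : (𝓞 K)ˣ) : x = 1 ∨ x = -1 := by
  obtain ⟨c, hc⟩ : ∃ c, p + 1 = 4 * c := ⟨(p + 1) / 4, by omega⟩
  obtain ⟨θ, hθ, hθ2⟩ := exists_theta hα hc
  obtain ⟨u, v, huv⟩ := int_rep' hp hp4 hα hgen hθ (x : 𝓞 K)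
  have hn := int_norm hp hα hgen hc hθ u v
  rw [← huv] at hn
  have hu : IsUnit (Algebra.norm ℤ (x : 𝓞 K)) := x.isUnit.map _
  have hc : (2 : ℤ) ≤ c := by omega
  rw [hn, Int.isUnit_iff] at hu
  have hle : u ^ 2 + u * v + c * v ^ 2 ≤ 1 := by rcases hu with h | h <;> omega
  have hv2 : v ^ 2 < 1 := by nlinarith [sq_nonneg (2 * u + v), sq_nonneg v]
  have hv : v = 0 := by
    by_contra h
    have : 0 < v ^ 2 := by positivity
    omega
  subst hv
  have hu2 : u ^ 2 = 1 := by rcases hu with h | h <;> nlinarith [sq_nonneg u]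
  rcases (by simpa using hu2 : u = 1 ∨ u = -1) with rfl | rfl
  · left; ext; simp [huv]
  · right; ext; simp [huv]

include hp hp4 hα hgen in
lemma K_torsion (h3 : 3 < p) : Units.torsionOrder K = 2 := by
  rw [Units.torsionOrder, Nat.card_eq_two_iff]
  have hm : (-1 : (𝓞 K)ˣ) ∈ Units.torsion K := by
    rw [Units.torsion, CommGroup.mem_torsion, isOfFinOrder_iff_pow_eq_one]
    exact ⟨2, by norm_num, by simp⟩
  refine ⟨1, ⟨-1, hm⟩, ?_, ?_⟩
  · intro h
    have h' : (1 : (𝓞 K)ˣ) = -1 := congrArg Subtype.val h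
    have h2 : (1 : 𝓞 K) = -1 := by simpa using congrArg Units.val h'
    have : (2 : 𝓞 K) = 0 := by linear_combination h2
    norm_num at this
  · ext ⟨x, hx⟩
    simp only [Set.mem_insert_iff, Set.mem_singleton_iff, Set.mem_univ, iff_true]
    rcases K_units hp hp4 hα hgen h3 x with rfl | rfl
    · left; rfl
    · right; rfl

include hp hp4 hα hgen in
lemma K_residue (h3 : 3 < p) :
    NumberField.dedekindZeta_residue K = Real.pi * NumberField.classNumber K / Real.sqrt p := by
  have hc := K_complex hp hα
  have h0 : InfinitePlace.nrRealPlaces K = 0 := IsTotallyComplex.nrRealPlaces_eq_zero K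
  have h1 : InfinitePlace.nrComplexPlaces K = 1 := by
    have := InfinitePlace.card_add_two_mul_card_eq_rank K
    rw [K_finrank hp.pos hα hgen, h0] at this
    omega
  have hcard : Fintype.card (InfinitePlace K) = 1 := by
    rw [InfinitePlace.card_eq_nrRealPlaces_add_nrComplexPlaces, h0, h1]
  have hreg : Units.regulator K = 1 := by
    classical
    rw [Units.regulator_eq_det']
    have : IsEmpty {w : InfinitePlace K // w ≠ Units.dirichletUnitTheorem.w₀} := by
      have hs := Fintype.card_le_one_iff_subsingleton.mp hcard.le
      exact ⟨fun w => w.2 (Subsingleton.elim _ _)⟩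
    rw [Matrix.det_isEmpty]; simp
  rw [NumberField.dedekindZeta_residue_def, h0, h1, hreg, K_torsion hp hp4 hα hgen h3,
    K_discr hp hp4 hα hgen]
  simp
  ring
end
end

section
open NumberField Ideal

section
variable (K : Type) [Field K] [NumberField K]

noncomputable def idc (n : ℕ) : ℕ := Nat.card {I : Ideal (𝓞 K) // absNorm I = n}

instance idc_finite (n : ℕ) : Finite {I : Ideal (𝓞 K) // absNorm I = n} := by
  exact (Ideal.finite_setOfPred_absNorm_eq n).to_subtype

variable {K}

lemma coprime_of_norm {m n : ℕ} (h : m.Coprime n) {I J : Ideal (𝓞 K)}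
    (hI : (m : 𝓞 K) ∈ I) (hJ : (n : 𝓞 K) ∈ J) : IsCoprime I J := by
  rw [Ideal.isCoprime_iff_exists]
  obtain ⟨a, b, hab⟩ := Nat.isCoprime_iff_coprime.mpr h
  refine ⟨(a : 𝓞 K) * m, I.mul_mem_left _ hI, (b : 𝓞 K) * n, J.mul_mem_left _ hJ, ?_⟩
  exact_mod_cast congrArg (Int.cast : ℤ → 𝓞 K) hab

lemma absNorm_natCast (m : ℕ) : absNorm (span {(m : 𝓞 K)}) = m ^ Module.finrank ℚ K := by
  rw [Ideal.absNorm_span_singleton]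
  have h := Algebra.norm_algebraMap (S := 𝓞 K) (m : ℤ)
  simp only [algebraMap_int_eq, eq_intCast, Int.cast_natCast] at h
  rw [h, RingOfIntegers.rank]
  simp [Int.natAbs_pow]

lemma idc_mul {m n : ℕ} (h : m.Coprime n) : idc K (m * n) = idc K m * idc K n := by
  unfold idc
  rw [← Nat.card_prod]
  symm
  refine Nat.card_eq_of_bijective (fun x => ⟨x.1.1 * x.2.1, by rw [map_mul, x.1.2, x.2.2]⟩) ⟨?_, ?_⟩
  · rintro ⟨⟨I, hI⟩, ⟨J, hJ⟩⟩ ⟨⟨I', hI'⟩, ⟨J', hJ'⟩⟩ heq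
    have heq : I * J = I' * J' := congrArg Subtype.val heq
    have mI : (m : 𝓞 K) ∈ I := hI ▸ absNorm_mem I
    have mI' : (m : 𝓞 K) ∈ I' := hI' ▸ absNorm_mem I'
    have mJ : (n : 𝓞 K) ∈ J := hJ ▸ absNorm_mem J
    have mJ' : (n : 𝓞 K) ∈ J' := hJ' ▸ absNorm_mem J'
    have e1 : I = I' := by
      apply dvd_antisymm
      · exact (coprime_of_norm h mI mJ').dvd_of_dvd_mul_right (heq ▸ dvd_mul_right I J)
      · exact (coprime_of_norm h mI' mJ).dvd_of_dvd_mul_right (heq ▸ dvd_mul_right I' J')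
    have e2 : J = J' := by
      apply dvd_antisymm
      · exact (coprime_of_norm h mI' mJ).symm.dvd_of_dvd_mul_left (heq ▸ dvd_mul_left J I)
      · exact (coprime_of_norm h mI mJ').symm.dvd_of_dvd_mul_left (heq ▸ dvd_mul_left J' I')
    subst e1 e2
    rfl
  · rintro ⟨I, hI⟩
    set J₁ := I ⊔ span {(m : 𝓞 K)} with hJ₁
    set J₂ := I ⊔ span {(n : 𝓞 K)} with hJ₂
    have m1 : (m : 𝓞 K) ∈ J₁ := (le_sup_right : _ ≤ J₁) (mem_span_singleton_self _)
    have m2 : (n : 𝓞 K) ∈ J₂ := (le_sup_right : _ ≤ J₂) (mem_span_singleton_self _)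
    have hcop : IsCoprime J₁ J₂ := coprime_of_norm h m1 m2
    have hprod : J₁ * J₂ = I := by
      apply le_antisymm
      · rw [hJ₁, hJ₂, Ideal.sup_mul, Ideal.mul_sup, Ideal.mul_sup, Ideal.span_singleton_mul_span_singleton]
        refine sup_le (sup_le Ideal.mul_le_right Ideal.mul_le_left) (sup_le Ideal.mul_le_right ?_)
        rw [Ideal.span_singleton_le_iff_mem]
        have := absNorm_mem I
        rw [hI] at this
        exact_mod_cast this
      · rw [Ideal.mul_eq_inf_of_isCoprime hcop]
        exact le_inf le_sup_left le_sup_left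
    have hN : absNorm J₁ * absNorm J₂ = m * n := by rw [← map_mul, hprod, hI]
    have d1 : absNorm J₁ ∣ m ^ Module.finrank ℚ K := by
      rw [← absNorm_natCast (K := K)]
      exact absNorm_dvd_absNorm_of_le le_sup_right
    have d2 : absNorm J₂ ∣ n ^ Module.finrank ℚ K := by
      rw [← absNorm_natCast (K := K)]
      exact absNorm_dvd_absNorm_of_le le_sup_right
    have c1 : (absNorm J₁).Coprime n := Nat.Coprime.coprime_dvd_left d1 (h.pow_left _)
    have c2 : (absNorm J₂).Coprime m := Nat.Coprime.coprime_dvd_left d2 (h.symm.pow_left _)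
    have e1 : absNorm J₁ = m := by
      apply Nat.dvd_antisymm
      · exact c1.dvd_of_dvd_mul_right (hN ▸ dvd_mul_right _ _)
      · exact c2.symm.dvd_of_dvd_mul_right (hN ▸ dvd_mul_right _ _)
    have e2 : absNorm J₂ = n := by
      apply Nat.dvd_antisymm
      · exact c2.dvd_of_dvd_mul_left (hN ▸ dvd_mul_left _ _)
      · exact c1.symm.dvd_of_dvd_mul_left (hN ▸ dvd_mul_left _ _)
    exact ⟨⟨⟨J₁, e1⟩, ⟨J₂, e2⟩⟩, Subtype.ext hprod⟩

lemma idc_one : idc K 1 = 1 := by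
  unfold idc
  simp [Ideal.absNorm_eq_one_iff]

lemma card_dvd {P : Ideal (𝓞 K)} (hP : absNorm P ≠ 0) (n : ℕ) :
    Nat.card {I : Ideal (𝓞 K) // absNorm I = absNorm P * n ∧ P ∣ I} = idc K n := by
  symm
  have hP0 : P ≠ 0 := by rintro rfl; simp at hP
  refine Nat.card_eq_of_bijective (fun J => ⟨P * J.1, by rw [map_mul, J.2], dvd_mul_right _ _⟩) ⟨?_, ?_⟩
  · rintro ⟨I, hI⟩ ⟨J, hJ⟩ h
    exact Subtype.ext (mul_left_cancel₀ hP0 (congrArg Subtype.val h))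
  · rintro ⟨I, hI, J, rfl⟩
    rw [map_mul] at hI
    exact ⟨⟨J, mul_left_cancel₀ hP hI⟩, rfl⟩

lemma exists_factor {q k : ℕ} (hq : q.Prime) {I : Ideal (𝓞 K)} (hI : absNorm I = q ^ (k + 1)) :
    ∃ Q : Ideal (𝓞 K), Prime Q ∧ Q ∣ I ∧ Q ∣ span {(q : 𝓞 K)} := by
  have h1 : I ≠ ⊤ := by
    intro h; rw [h] at hI; simp at hI; have := hq.one_lt; exact absurd hI.symm (Nat.one_lt_pow (by omega) this).ne'
  have h0 : I ≠ 0 := by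
    rintro rfl; simp at hI; have := hq.ne_zero; exact absurd hI.symm (pow_ne_zero _ this)
  obtain ⟨Q, hQi, hQI⟩ := WfDvdMonoid.exists_irreducible_factor (a := I) (by rwa [Ideal.isUnit_iff]) h0
  have hQ : Prime Q := hQi.prime
  refine ⟨Q, hQ, hQI, ?_⟩
  have hm : I ∣ span {(q : 𝓞 K)} ^ (k + 1) := by
    rw [Ideal.dvd_iff_le, Ideal.span_singleton_pow, Ideal.span_singleton_le_iff_mem]
    have := absNorm_mem I
    rw [hI] at this
    exact_mod_cast this
  exact hQ.dvd_of_dvd_pow (hQI.trans hm)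

lemma dvd_span_of_norm {q : ℕ} {P : Ideal (𝓞 K)} (hP : absNorm P = q) : P ∣ span {(q : 𝓞 K)} := by
  rw [Ideal.dvd_iff_le, Ideal.span_singleton_le_iff_mem, ← hP]
  exact absNorm_mem P

lemma eq_of_dvd_norm {I J : Ideal (𝓞 K)} (h : I ∣ J) (hn : absNorm I = absNorm J) (h0 : absNorm I ≠ 0) :
    I = J := by
  obtain ⟨L, rfl⟩ := h
  rw [map_mul] at hn
  have : absNorm L = 1 := by
    have : absNorm I * 1 = absNorm I * absNorm L := by rw [mul_one]; exact hn
    exact (mul_left_cancel₀ h0 this).symm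
  rw [Ideal.absNorm_eq_one_iff] at this
  rw [this, Ideal.mul_top]

end
end

section
open NumberField Ideal

section
variable {K : Type} [Field K] [NumberField K]

lemma prime_of_norm {q : ℕ} (hq : q.Prime) {P : Ideal (𝓞 K)} (hP : absNorm P = q) : Prime P := by
  have h0 : P ≠ ⊥ := by rintro rfl; simp at hP; exact hq.ne_zero hP.symm
  have := Ideal.isPrime_of_irreducible_absNorm (I := P) (by rw [hP]; exact hq)
  exact Ideal.prime_of_isPrime h0 this

lemma prime_dvd_prime {P Q : Ideal (𝓞 K)} (hP : Prime P) (hQ : Prime Q) (h : P ∣ Q) : P = Q :=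
  associated_iff_eq.mp ((hP.dvd_prime_iff_associated hQ).mp h)

lemma idc_case_zero (hd : Module.finrank ℚ K = 2) {q : ℕ} (hq : q.Prime) (h : idc K q = 0) (k : ℕ) :
    idc K (q ^ (k + 2)) = idc K (q ^ k) := by
  have hN : absNorm (span {(q : 𝓞 K)}) = q ^ 2 := by rw [absNorm_natCast, hd]
  have hN0 : absNorm (span {(q : 𝓞 K)}) ≠ 0 := by rw [hN]; exact pow_ne_zero _ hq.ne_zero
  rw [← card_dvd hN0 (q ^ k), hN]
  refine Nat.card_congr (Equiv.subtypeEquivRight fun I => ?_)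
  rw [← pow_add, add_comm 2 k, iff_self_and]
  intro hI
  obtain ⟨Q, hQ, hQI, hQq⟩ := exists_factor (k := k + 1) hq hI
  have hd' : absNorm Q ∣ q ^ 2 := by rw [← hN]; exact absNorm_dvd_absNorm_of_le (Ideal.dvd_iff_le.mp hQq)
  obtain ⟨j, hj, hQn⟩ := (Nat.dvd_prime_pow hq).mp hd'
  have hj2 : j = 2 := by
    have h0 : j ≠ 0 := by
      rintro rfl
      rw [pow_zero, Ideal.absNorm_eq_one_iff] at hQn
      exact hQ.not_isUnit (Ideal.isUnit_iff.mpr hQn)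
    have h1 : j ≠ 1 := by
      rintro rfl
      rw [pow_one] at hQn
      unfold idc at h
      have hem := Finite.card_eq_zero_iff.mp h
      exact hem.false ⟨Q, hQn⟩
    omega
  subst hj2
  rw [← eq_of_dvd_norm hQq (by rw [hQn, hN]) (by rw [hQn, ← hN]; exact hN0)]
  exact hQI

lemma idc_case_one (hd : Module.finrank ℚ K = 2) {q : ℕ} (hq : q.Prime) (h : idc K q = 1) (k : ℕ) :
    idc K (q ^ (k + 1)) = idc K (q ^ k) := by
  have hN : absNorm (span {(q : 𝓞 K)}) = q ^ 2 := by rw [absNorm_natCast, hd]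
  unfold idc at h
  obtain ⟨hs, ⟨P, hP⟩⟩ := Nat.card_eq_one_iff_unique.mp h
  have hu : ∀ Q : Ideal (𝓞 K), absNorm Q = q → Q = P := fun Q hQ =>
    congrArg Subtype.val (hs.elim ⟨Q, hQ⟩ ⟨P, hP⟩)
  have hP0 : absNorm P ≠ 0 := by rw [hP]; exact hq.ne_zero
  have hPP : span {(q : 𝓞 K)} = P * P := by
    obtain ⟨J, hJ⟩ := dvd_span_of_norm hP
    have : absNorm J = q := by
      rw [hJ, map_mul, hP, sq] at hN
      exact mul_left_cancel₀ hq.ne_zero hN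
    rw [hJ, hu J this]
  rw [← card_dvd hP0 (q ^ k), hP]
  refine Nat.card_congr (Equiv.subtypeEquivRight fun I => ?_)
  rw [← pow_succ', iff_self_and]
  intro hI
  obtain ⟨Q, hQ, hQI, hQq⟩ := exists_factor hq hI
  rw [hPP] at hQq
  have : Q ∣ P := by rcases hQ.dvd_or_dvd hQq with h | h <;> exact h
  rw [← prime_dvd_prime hQ (prime_of_norm hq hP) this]
  exact hQI

lemma idc_case_two (hd : Module.finrank ℚ K = 2) {q : ℕ} (hq : q.Prime) (h : idc K q = 2) (k : ℕ) :
    idc K (q ^ (k + 1)) = idc K (q ^ k) + 1 := by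
  have hN : absNorm (span {(q : 𝓞 K)}) = q ^ 2 := by rw [absNorm_natCast, hd]
  unfold idc at h
  obtain ⟨⟨P, hP⟩, ⟨Q, hQ⟩, hPQ, -⟩ := Nat.card_eq_two_iff.mp h
  have hPQ : P ≠ Q := fun h => hPQ (Subtype.ext h)
  have hP0 : absNorm P ≠ 0 := by rw [hP]; exact hq.ne_zero
  have pP := prime_of_norm hq hP
  have pQ := prime_of_norm hq hQ
  have hprod : span {(q : 𝓞 K)} = P * Q := by
    obtain ⟨J, hJ⟩ := dvd_span_of_norm hP
    have hJn : absNorm J = q := by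
      rw [hJ, map_mul, hP, sq] at hN
      exact mul_left_cancel₀ hq.ne_zero hN
    have hQJ : Q ∣ P * J := hJ ▸ dvd_span_of_norm hQ
    rcases pQ.dvd_or_dvd hQJ with h | h
    · exact absurd (prime_dvd_prime pQ pP h).symm hPQ
    · rw [hJ, eq_of_dvd_norm h (by rw [hQ, hJn]) (by rw [hQ]; exact hq.ne_zero)]
  have key : ∀ (k : ℕ) (I : Ideal (𝓞 K)), absNorm I = q ^ k → ¬ P ∣ I → I = Q ^ k := by
    intro k
    induction k with
    | zero =>
      intro I hI _
      rw [pow_zero, Ideal.absNorm_eq_one_iff] at hI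
      rw [hI, pow_zero, Ideal.one_eq_top]
    | succ k ih =>
      intro I hI hPI
      obtain ⟨Q', hQ', hQI, hQq⟩ := exists_factor hq hI
      rw [hprod] at hQq
      rcases hQ'.dvd_or_dvd hQq with h | h
      · exact absurd (prime_dvd_prime hQ' pP h ▸ hQI) hPI
      · obtain ⟨J, rfl⟩ := prime_dvd_prime hQ' pQ h ▸ hQI
        rw [map_mul, hQ, pow_succ'] at hI
        rw [ih J (mul_left_cancel₀ hq.ne_zero hI) (fun h => hPI (h.mul_left _)), pow_succ']
  have hsplit : idc K (q ^ (k + 1)) =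
      Nat.card {I : Ideal (𝓞 K) // absNorm I = absNorm P * q ^ k ∧ P ∣ I} +
      Nat.card {I : Ideal (𝓞 K) // absNorm I = q ^ (k + 1) ∧ ¬ P ∣ I} := by
    rw [hP, ← pow_succ']
    have hf : {I : Ideal (𝓞 K) | absNorm I = q ^ (k + 1)}.Finite :=
      Ideal.finite_setOfPred_absNorm_eq _
    exact (Set.ncard_inter_add_ncard_sdiff_eq_ncard {I : Ideal (𝓞 K) | absNorm I = q ^ (k + 1)}
      {I | P ∣ I} hf).symm
  rw [hsplit, card_dvd hP0]
  congr 1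
  rw [Nat.card_eq_one_iff_unique]
  refine ⟨⟨?_⟩, ⟨Q ^ (k + 1), by rw [map_pow, hQ], ?_⟩⟩
  · rintro ⟨I, hI, hI'⟩ ⟨J, hJ, hJ'⟩
    exact Subtype.ext ((key _ I hI hI').trans (key _ J hJ hJ').symm)
  · intro h
    exact hPQ (prime_dvd_prime pP pQ (pP.dvd_of_dvd_pow h))

lemma idc_prime_pow (hd : Module.finrank ℚ K = 2) {q : ℕ} (hq : q.Prime) (e : ℤ)
    (he : e = -1 ∨ e = 0 ∨ e = 1) (h : (idc K q : ℤ) = 1 + e) (k : ℕ) :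
    (idc K (q ^ k) : ℤ) = ∑ i ∈ Finset.range (k + 1), e ^ i := by
  rcases he with rfl | rfl | rfl
  · have h0 : idc K q = 0 := by omega
    induction k using Nat.twoStepInduction with
    | zero => simp [idc_one]
    | one => simp [h0, Finset.sum_range_succ]
    | more k ih _ =>
      rw [idc_case_zero hd hq h0, ih, Finset.sum_range_succ _ (k + 2), Finset.sum_range_succ _ (k + 1)]
      ring
  · have h0 : idc K q = 1 := by omega
    induction k with
    | zero => simp [idc_one]
    | succ k ih => rw [idc_case_one hd hq h0, ih, Finset.sum_range_succ _ (k + 1)]; simp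
  · have h0 : idc K q = 2 := by omega
    induction k with
    | zero => simp [idc_one]
    | succ k ih => rw [idc_case_two hd hq h0, Finset.sum_range_succ _ (k + 1), ← ih]; simp
end
end

section
open NumberField Ideal

section
variable {p : ℕ} (hp : p.Prime) (hp4 : p % 4 = 3) {K : Type} [Field K] [NumberField K] {α : K}
    (hα : α ^ 2 = -(p : K)) (hgen : IntermediateField.adjoin ℚ {α} = ⊤)
    {c : ℕ} (hc : p + 1 = 4 * c)

lemma idc_homs {q : ℕ} (hq : q.Prime) : idc K q = Nat.card (𝓞 K →+* ZMod q) := by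
  have : Fact q.Prime := ⟨hq⟩
  have hint : ∀ (f : 𝓞 K →+* ZMod q) (z : 𝓞 K), ∃ n : ℤ, z - n ∈ RingHom.ker f := by
    intro f z
    obtain ⟨n, hn⟩ := ZMod.intCast_surjective (f z)
    exact ⟨n, by rw [RingHom.mem_ker, map_sub, map_intCast, hn, sub_self]⟩
  symm
  refine Nat.card_eq_of_bijective (fun f => ⟨RingHom.ker f, ?_⟩) ⟨?_, ?_⟩
  · have hs : Function.Surjective f := by
      intro y
      obtain ⟨n, hn⟩ := ZMod.intCast_surjective y
      exact ⟨n, by rw [map_intCast, hn]⟩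
    rw [Ideal.absNorm_apply, Submodule.cardQuot_apply]
    rw [Nat.card_congr (RingHom.quotientKerEquivOfSurjective hs).toEquiv, Nat.card_zmod]
  · intro f g h
    have h : RingHom.ker f = RingHom.ker g := congrArg Subtype.val h
    ext z
    obtain ⟨n, hn⟩ := hint f z
    have hn' := hn
    rw [h] at hn'
    rw [RingHom.mem_ker, map_sub, map_intCast, sub_eq_zero] at hn hn'
    rw [hn, hn']
  · rintro ⟨I, hI⟩
    have hcard : Nat.card (𝓞 K ⧸ I) = q := by
      rw [← hI, Ideal.absNorm_apply, Submodule.cardQuot_apply]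
    have : Finite (𝓞 K ⧸ I) := Nat.finite_of_card_ne_zero (by rw [hcard]; exact hq.ne_zero)
    have := Fintype.ofFinite (𝓞 K ⧸ I)
    let e := ZMod.ringEquivOfPrime (𝓞 K ⧸ I) hq (by rw [← Nat.card_eq_fintype_card, hcard])
    refine ⟨e.symm.toRingHom.comp (Ideal.Quotient.mk I), Subtype.ext ?_⟩
    ext z
    simp [RingHom.mem_ker, Ideal.Quotient.eq_zero_iff_mem]

include hp hp4 hα hgen hc in
lemma homs_roots {q : ℕ} :
    Nat.card (𝓞 K →+* ZMod q) = Nat.card {r : ZMod q // r * r = r - c} := by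
  obtain ⟨θ, hθ, hθ2⟩ := exists_theta hα hc
  refine Nat.card_eq_of_bijective (fun f => ⟨f θ, by rw [← map_mul, hθ2]; simp⟩) ⟨?_, ?_⟩
  · intro f g h
    have h : f θ = g θ := congrArg Subtype.val h
    ext z
    obtain ⟨u, v, rfl⟩ := int_rep' hp hp4 hα hgen hθ z
    simp [h]
  · rintro ⟨r, hr⟩
    choose u v h using int_rep' hp hp4 hα hgen hθ
    have uniq : ∀ (z : 𝓞 K) (a b : ℤ), z = a + b * θ → u z = a ∧ v z = b := by
      intro z a b hz
      have := int_indep hp hα hθ (u z - a) (v z - b) (by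
        push_cast; linear_combination hz - h z)
      constructor <;> omega
    have u1 := uniq 1 1 0 (by simp)
    have u0 := uniq 0 0 0 (by simp)
    have ut := uniq θ 0 1 (by simp)
    let f : 𝓞 K →+* ZMod q :=
      { toFun := fun z => (u z : ZMod q) + v z * r
        map_one' := by rw [u1.1, u1.2]; simp
        map_zero' := by rw [u0.1, u0.2]; simp
        map_add' := fun x y => by
          have := uniq (x + y) (u x + u y) (v x + v y) (by
            push_cast; linear_combination h x + h y)
          rw [this.1, this.2]; push_cast; ring
        map_mul' := fun x y => by
          have := uniq (x * y) (u x * u y - c * (v x * v y)) (u x * v y + v x * u y + v x * v y) (by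
            push_cast
            linear_combination y * h x + (u x + v x * θ : 𝓞 K) * h y + (v x * v y : 𝓞 K) * hθ2)
          rw [this.1, this.2]; push_cast
          linear_combination (-(v x * v y) : ZMod q) * hr }
    refine ⟨f, Subtype.ext ?_⟩
    change (u θ : ZMod q) + v θ * r = r
    rw [ut.1, ut.2]; simp

lemma two_a : ((Nat.card {r : ZMod 2 // r * r = r - 0} : ℕ) : ℤ) = 1 + 1 := by
  rw [Nat.card_eq_fintype_card]; decide

lemma two_b : ((Nat.card {r : ZMod 2 // r * r = r - 1} : ℕ) : ℤ) = 1 + -1 := by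
  rw [Nat.card_eq_fintype_card]; decide

lemma two_c : (2 : ZMod 2) = 0 := by decide

include hp4 hc in
lemma roots_card [Fact p.Prime] {q : ℕ} (hq : q.Prime) :
    (Nat.card {r : ZMod q // r * r = r - c} : ℤ) = 1 + quadraticChar (ZMod p) (q : ZMod p) := by
  have : Fact q.Prime := ⟨hq⟩
  have hp2 : p ≠ 2 := by rintro rfl; simp at hp4
  have hleg : quadraticChar (ZMod p) (q : ZMod p) = legendreSym p q := by simp [legendreSym]
  rw [hleg]
  rcases eq_or_ne q 2 with rfl | hq2
  · have h2 := legendreSym.at_two (p := p) hp2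
    push_cast
    rw [h2, ZMod.χ₈_nat_eq_if_mod_eight]
    rcases Nat.even_or_odd c with ⟨d, hd⟩ | ⟨d, hd⟩
    · have : (c : ZMod 2) = 0 := by rw [ZMod.natCast_eq_zero_iff]; omega
      rw [this]
      have h7 : p % 8 = 7 := by omega
      have h1 : p % 2 ≠ 0 := by omega
      rw [if_neg h1, if_pos (Or.inr h7)]
      exact two_a
    · have : (c : ZMod 2) = 1 := by
        rw [hd]; push_cast
        have : (2 : ZMod 2) = 0 := two_c
        rw [this]; ring
      rw [this]
      have h1 : p % 2 ≠ 0 := by omega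
      rw [if_neg h1, if_neg (by omega)]
      exact two_b
  · have hcs := legendreSym.card_sqrts q hq2 (-(p : ℤ))
    have hrec : legendreSym q (-(p : ℤ)) = legendreSym p q := by
      have e : -(p : ℤ) = (-1) * p := by ring
      rw [e, legendreSym.mul, legendreSym.at_neg_one hq2]
      have hqodd : q % 2 = 1 := hq.eq_two_or_odd.resolve_left hq2
      rcases (by omega : q % 4 = 1 ∨ q % 4 = 3) with h | h
      · rw [ZMod.χ₄_nat_one_mod_four h, one_mul]
        exact (legendreSym.quadratic_reciprocity_one_mod_four h hp2).symm
      · rw [ZMod.χ₄_nat_three_mod_four h, legendreSym.quadratic_reciprocity_three_mod_four hp4 h]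
        ring
    rw [← hrec, add_comm, ← hcs, Set.toFinset_card, ← Nat.card_eq_fintype_card]
    congr 1
    have h2 : (2 : ZMod q) ≠ 0 := by
      intro h
      have : ((2 : ℕ) : ZMod q) = 0 := by exact_mod_cast h
      rw [ZMod.natCast_eq_zero_iff] at this
      exact hq2 ((Nat.prime_dvd_prime_iff_eq hq Nat.prime_two).mp this)
    have h4 : (4 : ZMod q) ≠ 0 := by
      have : (4 : ZMod q) = 2 * 2 := by norm_num
      rw [this]; exact mul_ne_zero h2 h2
    have hcq : (p : ZMod q) + 1 = 4 * c := by exact_mod_cast congrArg (Nat.cast : ℕ → ZMod q) hc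
    refine Nat.card_eq_of_bijective (fun r => ⟨2 * r.1 - 1, ?_⟩) ⟨?_, ?_⟩
    · change (2 * r.1 - 1) ^ 2 = ((-(p : ℤ) : ℤ) : ZMod q)
      push_cast
      linear_combination 4 * r.2 + hcq
    · rintro ⟨r, hr⟩ ⟨s, hs⟩ h
      have h : 2 * r - 1 = 2 * s - 1 := congrArg Subtype.val h
      exact Subtype.ext (mul_left_cancel₀ h2 (sub_left_injective h))
    · rintro ⟨x, hx⟩
      have hx : x ^ 2 = ((-(p : ℤ) : ℤ) : ZMod q) := hx
      push_cast at hx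
      have hh : 2 * ((x + 1) / 2) = x + 1 := by field_simp
      refine ⟨⟨(x + 1) / 2, ?_⟩, Subtype.ext ?_⟩
      · apply mul_left_cancel₀ h4
        generalize (x + 1) / 2 = r at *
        have : x = 2 * r - 1 := by linear_combination -hh
        subst this
        linear_combination hx - hcq
      · change 2 * ((x + 1) / 2) - 1 = x
        rw [hh]; ring

include hp4 hα hgen in
lemma idc_prime [Fact p.Prime] {q : ℕ} (hq : q.Prime) :
    (idc K q : ℤ) = 1 + quadraticChar (ZMod p) (q : ZMod p) := by
  obtain ⟨c, hc⟩ : ∃ c, p + 1 = 4 * c := ⟨(p + 1) / 4, by omega⟩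
  rw [idc_homs hq, homs_roots Fact.out hp4 hα hgen hc, roots_card hp4 hc hq]
end
end

section
open NumberField Ideal ArithmeticFunction
open scoped ArithmeticFunction.zeta LSeries.notation

section
variable {p : ℕ} [Fact p.Prime] (hp4 : p % 4 = 3) {K : Type} [Field K] [NumberField K] {α : K}
    (hα : α ^ 2 = -(p : K)) (hgen : IntermediateField.adjoin ℚ {α} = ⊤)

noncomputable def idcA (K : Type) [Field K] [NumberField K] : ArithmeticFunction ℤ :=
  ⟨fun n => if n = 0 then 0 else (idc K n : ℤ), by simp⟩

noncomputable def chiA (p : ℕ) [Fact p.Prime] : ArithmeticFunction ℤ :=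
  ⟨fun n => quadraticChar (ZMod p) (n : ZMod p), by simp⟩

lemma idcA_mult : (idcA K).IsMultiplicative := by
  rw [IsMultiplicative.iff_ne_zero]
  refine ⟨by simp [idcA, idc_one], fun {m n} hm hn h => ?_⟩
  simp [idcA, hm, hn, idc_mul h]

lemma chiA_mult : (chiA p).IsMultiplicative := by
  rw [IsMultiplicative.iff_ne_zero]
  refine ⟨by simp [chiA], fun {m n} hm hn h => ?_⟩
  simp only [chiA, coe_mk]
  rw [Nat.cast_mul, map_mul]

include hp4 hα hgen in
lemma idcA_eq : idcA K = (ζ : ArithmeticFunction ℤ) * chiA p := by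
  rw [(IsMultiplicative.eq_iff_eq_on_prime_powers _ idcA_mult _
    (isMultiplicative_zeta.natCast.mul chiA_mult))]
  intro q i hq
  rw [coe_zeta_mul_apply, Nat.sum_divisors_prime_pow hq]
  have hpp : p.Prime := Fact.out
  have h := idc_prime_pow (K_finrank hpp.pos hα hgen) hq (quadraticChar (ZMod p) (q : ZMod p))
    (by
      have := quadraticChar_isQuadratic (ZMod p) (q : ZMod p)
      tauto) (idc_prime hp4 hα hgen hq) i
  simp only [idcA, chiA, coe_mk]
  rw [if_neg (pow_ne_zero _ hq.ne_zero), h]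
  refine Finset.sum_congr rfl fun j _ => ?_
  rw [Nat.cast_pow, map_pow]

include hp4 hα hgen in
lemma zeta_eq {s : ℂ} (hs : 1 < s.re) :
    dedekindZeta K s = riemannZeta s * DirichletCharacter.LFunction (qchi p) s := by
  rw [DirichletCharacter.LFunction_eq_LSeries _ hs, ← LSeries_one_eq_riemannZeta hs,
    ← LSeries_convolution' (LSeriesSummable_one_iff.mpr hs)
      (DirichletCharacter.LSeriesSummable_of_one_lt_re (qchi p) hs), dedekindZeta]
  refine LSeries_congr (fun {n} hn => ?_) s
  have h := congrArg (fun f : ArithmeticFunction ℤ => ((f n : ℤ) : ℂ)) (idcA_eq hp4 hα hgen)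
  simp only [coe_zeta_mul_apply] at h
  rw [LSeries.convolution_def]
  simp only [Pi.one_apply, one_mul]
  rw [Nat.sum_divisorsAntidiagonal' (f := fun _ j => qchi p (j : ZMod p))]
  simp only [idcA, chiA, coe_mk, if_neg hn] at h
  push_cast at h
  simp only [qchi_apply]
  exact h

include hp4 hα hgen in
lemma residue_eq : (dedekindZeta_residue K : ℂ) = DirichletCharacter.LFunction (qchi p) 1 := by
  have h1 := tendsto_sub_one_mul_dedekindZeta_nhdsGT K
  have hl : Filter.Tendsto (fun s : ℝ => (s : ℂ)) (nhdsWithin 1 (Set.Ioi 1)) (nhdsWithin 1 {1}ᶜ) := by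
    refine tendsto_nhdsWithin_iff.mpr ⟨?_, ?_⟩
    · have := (Complex.continuous_ofReal.tendsto (1 : ℝ))
      rw [Complex.ofReal_one] at this
      exact this.mono_left nhdsWithin_le_nhds
    · filter_upwards [self_mem_nhdsWithin] with s hs
      have : s ≠ 1 := ne_of_gt hs
      simpa using this
  have hL : Filter.Tendsto (DirichletCharacter.LFunction (qchi p)) (nhdsWithin 1 {1}ᶜ)
      (nhds (DirichletCharacter.LFunction (qchi p) 1)) :=
    ((DirichletCharacter.differentiable_LFunction (qchi_ne_one p hp4)).continuous.tendsto 1).mono_left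
      nhdsWithin_le_nhds
  have h2 := (riemannZeta_residue_one.mul hL).comp hl
  rw [one_mul] at h2
  refine tendsto_nhds_unique h1 (h2.congr' ?_)
  filter_upwards [self_mem_nhdsWithin] with s hs
  have hs' : 1 < (s : ℂ).re := by simpa using hs
  simp only [Function.comp]
  rw [zeta_eq hp4 hα hgen hs', mul_assoc]

include hp4 hα hgen in
lemma sum_j_chi (h3 : 3 < p) : ∑ j ∈ Finset.range p, (j : ℤ) * quadraticChar (ZMod p) (j : ZMod p) =
    - (p * classNumber K) := by
  have h := residue_eq hp4 hα hgen
  rw [K_residue Fact.out hp4 hα hgen h3, L_one p hp4] at h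
  have hpp : p.Prime := Fact.out
  have hp0 : (p : ℂ) ≠ 0 := by exact_mod_cast hpp.ne_zero
  have hs0 : (Real.sqrt p : ℂ) ≠ 0 := by
    have : Real.sqrt p ≠ 0 := (Real.sqrt_pos.mpr (by exact_mod_cast hpp.pos)).ne'
    exact_mod_cast this
  have hpi : (Real.pi : ℂ) ≠ 0 := by exact_mod_cast Real.pi_ne_zero
  have : ((∑ j ∈ Finset.range p, (j : ℤ) * quadraticChar (ZMod p) (j : ZMod p) : ℤ) : ℂ) =
      ((- (p * classNumber K) : ℤ) : ℂ) := by
    push_cast at h ⊢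
    generalize ∑ j ∈ Finset.range p, (j : ℂ) * (quadraticChar (ZMod p) (j : ZMod p) : ℂ) = S at *
    field_simp at h
    linear_combination h
  exact_mod_cast this
end

lemma sum_res (p : ℕ) [Fact p.Prime] (h3 : 3 < p) :
    ∑ a ∈ (Finset.Icc 1 (p - 1)).filter (fun a : ℕ => legendreSym p (a : ℤ) = 1), ((a : ℚ) / p) =
      ((p : ℚ) - 1) / 4 + (1 / (2 * p)) *
        ((∑ j ∈ Finset.range p, (j : ℤ) * quadraticChar (ZMod p) (j : ZMod p) : ℤ) : ℚ) := by
  have hpp : p.Prime := Fact.out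
  have hp0 : (p : ℚ) ≠ 0 := by exact_mod_cast hpp.ne_zero
  have hsub : Finset.Icc 1 (p - 1) ⊆ Finset.range p := by
    intro a ha; rw [Finset.mem_Icc] at ha; rw [Finset.mem_range]; omega
  have e0 : ∑ a ∈ (Finset.Icc 1 (p - 1)).filter (fun a : ℕ => legendreSym p (a : ℤ) = 1), ((a : ℚ) / p)
      = ∑ a ∈ Finset.range p, (1 / (2 * p) * (a : ℚ) +
        1 / (2 * p) * (a * (quadraticChar (ZMod p) (a : ZMod p) : ℚ))) := by
    rw [Finset.sum_filter, ← Finset.sum_subset hsub]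
    · refine Finset.sum_congr rfl fun a ha => ?_
      rw [Finset.mem_Icc] at ha
      have hl : legendreSym p (a : ℤ) = quadraticChar (ZMod p) (a : ZMod p) := by simp [legendreSym]
      have hne : (a : ZMod p) ≠ 0 := by
        rw [Ne, ZMod.natCast_eq_zero_iff]
        intro hd
        have := Nat.le_of_dvd (by omega) hd
        omega
      rw [hl]
      rcases quadraticChar_dichotomy hne with h | h
      · rw [if_pos h, h]; push_cast; field_simp; ring
      · rw [if_neg (by rw [h]; decide), h]; push_cast; ring
    · intro a ha ha'
      have : a = 0 := by
        rw [Finset.mem_range] at ha; rw [Finset.mem_Icc] at ha'; omega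
      subst this; simp
  have hg : ∑ a ∈ Finset.range p, (a : ℚ) = p * (p - 1) / 2 := by
    have := Finset.sum_range_id_mul_two p
    have h2 : ((∑ a ∈ Finset.range p, a : ℕ) : ℚ) * 2 = p * (p - 1) := by
      have h1 : ((p - 1 : ℕ) : ℚ) = p - 1 := by rw [Nat.cast_sub (by omega)]; simp
      rw [← h1]; exact_mod_cast this
    push_cast at h2
    linarith
  rw [e0, Finset.sum_add_distrib, ← Finset.mul_sum, ← Finset.mul_sum, hg]
  push_cast
  field_simp
  ring

lemma sum_one_mod (p : ℕ) [Fact p.Prime] (hp1 : p % 4 = 1) :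
    ∑ j ∈ Finset.range p, (j : ℤ) * quadraticChar (ZMod p) (j : ZMod p) = 0 := by
  have hpp : p.Prime := Fact.out
  have hp2 : p ≠ 2 := by rintro rfl; simp at hp1
  have hneg : quadraticChar (ZMod p) (-1) = 1 := by
    rw [quadraticChar_neg_one ((ZMod.ringChar_zmod_n p).substr hp2), ZMod.card,
      ZMod.χ₄_nat_one_mod_four hp1]
  have hz : ∑ j ∈ Finset.range p, quadraticChar (ZMod p) (j : ZMod p) = 0 := by
    have := quadraticChar_sum_zero (F := ZMod p) ((ZMod.ringChar_zmod_n p).substr hp2)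
    have h2 := sum_zmod p (fun a => ((quadraticChar (ZMod p) a : ℤ) : ℂ))
    rw [← Int.cast_sum, this] at h2
    exact_mod_cast h2.symm
  obtain ⟨n, rfl⟩ : ∃ n, p = n + 1 := ⟨p - 1, by have := hpp.pos; omega⟩
  have hrefl : ∑ j ∈ Finset.range n, ((j + 1 : ℕ) : ℤ) * quadraticChar (ZMod (n + 1)) ((j + 1 : ℕ) : ZMod (n + 1)) =
      ∑ j ∈ Finset.range n, ((n + 1 : ℤ) - ((j + 1 : ℕ) : ℤ)) *
        quadraticChar (ZMod (n + 1)) ((j + 1 : ℕ) : ZMod (n + 1)) := by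
    rw [← Finset.sum_range_reflect]
    refine Finset.sum_congr rfl fun j hj => ?_
    rw [Finset.mem_range] at hj
    have e : n - 1 - j + 1 = n - j := by omega
    have e1 : ((n - j : ℕ) : ℤ) = (n + 1 : ℤ) - ((j + 1 : ℕ) : ℤ) := by
      push_cast [Nat.cast_sub hj.le]; ring
    have e2 : ((n - j : ℕ) : ZMod (n + 1)) = -1 * ((j + 1 : ℕ) : ZMod (n + 1)) := by
      have h0 : ((n + 1 : ℕ) : ZMod (n + 1)) = 0 := ZMod.natCast_self _
      push_cast [Nat.cast_sub hj.le] at h0 ⊢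
      linear_combination h0
    rw [e, e1, e2, map_mul, hneg, one_mul]
  rw [Finset.sum_range_succ'] at hz ⊢
  simp only [sub_mul, Finset.sum_sub_distrib, ← Finset.mul_sum] at hrefl
  simp only [Nat.cast_zero, MulChar.map_zero, add_zero, mul_zero] at hz ⊢
  rw [hz] at hrefl
  linarith
end

/-- For a prime `p > 3` and `h_p` the class number of the imaginary
quadratic field `ℚ(√-p)` (a number field `K` generated over `ℚ` by a square root `α`
of `-p`): the sum of `a/p` over quadratic residues `1 ≤ a ≤ p-1` equals `(p-1)/4` if
`p ≡ 1 (mod 4)`, and equals `(p-1)/4 - h_p/2` if `p ≡ 3 (mod 4)`. -/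
theorem sum_quadratic_residues_div_p (p : ℕ) [Fact p.Prime] (hp3 : 3 < p)
    (K : Type) [Field K] [NumberField K] (α : K) (hα : α ^ 2 = -(p : K))
    (hgen : IntermediateField.adjoin ℚ {α} = ⊤) :
    (p % 4 = 1 →
      ∑ a ∈ (Finset.Icc 1 (p - 1)).filter (fun a : ℕ => legendreSym p (a : ℤ) = 1), ((a : ℚ) / p) =
        ((p : ℚ) - 1) / 4) ∧
    (p % 4 = 3 →
      ∑ a ∈ (Finset.Icc 1 (p - 1)).filter (fun a : ℕ => legendreSym p (a : ℤ) = 1), ((a : ℚ) / p) =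
        ((p : ℚ) - 1) / 4 - (NumberField.classNumber K : ℚ) / 2) := by
  have hp0 : (p : ℚ) ≠ 0 := by exact_mod_cast (Fact.out : p.Prime).ne_zero
  refine ⟨fun h => ?_, fun h => ?_⟩
  · rw [sum_res p hp3, sum_one_mod p h]; simp
  · rw [sum_res p hp3, sum_j_chi h hα hgen hp3]
    push_cast
    field_simp
    ring
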